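/- arXiv:2010.12311 — 3 statements merged into one kernel-verified Lean document; each statement's English description precedes it below -/
import Mathlib

section
/- Let N ∈ {3,4,5,6}, λ > 0, m ≥ 1, and let u be a radial solution of the Brezis–Nirenberg problem on the unit ball with m nodal zones for the parameter λ, with first zero r_λ. Then: if N ∈ {4,5,6}, one has 0 < λ·r_λ² < μ₁; if N = 3, one has π²/4 < λ·r_λ² < π². -/
open Real Set Filter Topology

/-- A radial solution of the Brezis–Nirenberg problem `-Δu = |u|^{4/(N-2)} u + λ u`
on the unit ball of `ℝ^N` with `m` nodal zones: a `C²` function `u` on `[0,1]`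
(given together with its first and second derivatives `u'`, `u''`) satisfying the
radial ODE, `u'(0) = 0`, `u(1) = 0`, `u(0) > 0`, with exactly `m - 1` zeros in `(0,1)`. -/
structure BNSol (N : ℕ) (lam : ℝ) (m : ℕ) (u u' u'' : ℝ → ℝ) : Prop where
  deriv_fst : ∀ r ∈ Set.Icc (0:ℝ) 1, HasDerivWithinAt u (u' r) (Set.Icc (0:ℝ) 1) r
  deriv_snd : ∀ r ∈ Set.Icc (0:ℝ) 1, HasDerivWithinAt u' (u'' r) (Set.Icc (0:ℝ) 1) r
  cont_snd : ContinuousOn u'' (Set.Icc (0:ℝ) 1)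
  ode : ∀ r ∈ Set.Ioo (0:ℝ) 1,
    u'' r + (((N:ℝ) - 1) / r) * u' r + |u r| ^ ((4:ℝ) / ((N:ℝ) - 2)) * u r + lam * u r = 0
  bc_deriv_zero : u' 0 = 0
  bc_one : u 1 = 0
  pos_zero : 0 < u 0
  nodal : {r : ℝ | r ∈ Set.Ioo (0:ℝ) 1 ∧ u r = 0}.ncard = m - 1

/-- `ρ` is the first zero of `u` in `(0,1]`. -/
def IsFirstZero (u : ℝ → ℝ) (ρ : ℝ) : Prop :=
  ρ ∈ Set.Ioc (0:ℝ) 1 ∧ u ρ = 0 ∧ ∀ s ∈ Set.Ioo (0:ℝ) ρ, u s ≠ 0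

/-- `μ` is a radial Dirichlet eigenvalue of `-Δ` on the unit ball of `ℝ^N`. -/
def IsRadialEigenvalue (N : ℕ) (μ : ℝ) : Prop :=
  0 < μ ∧ ∃ ψ ψ' ψ'' : ℝ → ℝ,
    (∃ r ∈ Set.Icc (0:ℝ) 1, ψ r ≠ 0) ∧
    (∀ r ∈ Set.Icc (0:ℝ) 1, HasDerivWithinAt ψ (ψ' r) (Set.Icc (0:ℝ) 1) r) ∧
    (∀ r ∈ Set.Icc (0:ℝ) 1, HasDerivWithinAt ψ' (ψ'' r) (Set.Icc (0:ℝ) 1) r) ∧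
    (∀ r ∈ Set.Ioo (0:ℝ) 1, ψ'' r + (((N:ℝ) - 1) / r) * ψ' r + μ * ψ r = 0) ∧
    ψ' 0 = 0 ∧ ψ 1 = 0

/-- The first radial Dirichlet eigenvalue of `-Δ` on the unit ball of `ℝ^N`. -/
noncomputable def mu1 (N : ℕ) : ℝ := sInf {μ : ℝ | IsRadialEigenvalue N μ}

/-- Poisson integral. -/
noncomputable def Phi (k : ℕ) (t : ℝ) : ℝ := ∫ θ in (0:ℝ)..π, cos (t * cos θ) * sin θ ^ k
noncomputable def Phi1 (k : ℕ) (t : ℝ) : ℝ :=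
  ∫ θ in (0:ℝ)..π, -(sin (t * cos θ) * cos θ) * sin θ ^ k
noncomputable def Phi2 (k : ℕ) (t : ℝ) : ℝ :=
  ∫ θ in (0:ℝ)..π, -(cos (t * cos θ) * cos θ * cos θ) * sin θ ^ k

lemma abs_sin_pow_le (k : ℕ) (θ : ℝ) : |sin θ ^ k| ≤ 1 := by
  rw [abs_pow]
  exact pow_le_one₀ (abs_nonneg _) (abs_sin_le_one θ)

lemma Phi_hasDerivAt (k : ℕ) (t : ℝ) : HasDerivAt (Phi k) (Phi1 k t) t := by
  unfold Phi Phi1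
  refine (intervalIntegral.hasDerivAt_integral_of_dominated_loc_of_deriv_le
    (F := fun t θ => cos (t * cos θ) * sin θ ^ k)
    (F' := fun t θ => -(sin (t * cos θ) * cos θ) * sin θ ^ k)
    (s := Set.univ) (bound := fun _ => 1) Filter.univ_mem ?_ ?_ ?_ ?_ ?_ ?_).2
  · exact Filter.Eventually.of_forall fun x =>
      (by fun_prop : Continuous fun θ => cos (x * cos θ) * sin θ ^ k).aestronglyMeasurable
  · exact (by fun_prop : Continuous fun θ => cos (t * cos θ) * sin θ ^ k).intervalIntegrable _ _
  · exact (by fun_prop :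
      Continuous fun θ => -(sin (t * cos θ) * cos θ) * sin θ ^ k).aestronglyMeasurable
  · refine Filter.Eventually.of_forall fun θ _ x _ => ?_
    rw [Real.norm_eq_abs, abs_mul, abs_neg, abs_mul]
    exact mul_le_one₀ (mul_le_one₀ (abs_sin_le_one _) (abs_nonneg _) (abs_cos_le_one _))
      (abs_nonneg _) (abs_sin_pow_le k θ)
  · exact intervalIntegrable_const
  · refine Filter.Eventually.of_forall fun θ _ x _ => ?_
    have h1 : HasDerivAt (fun x : ℝ => x * cos θ) (cos θ) x := by
      simpa using (hasDerivAt_id x).mul_const (cos θ)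
    have := (h1.cos).mul_const (sin θ ^ k)
    refine this.congr_deriv (Eq.symm ?_)
    ring

lemma Phi1_hasDerivAt (k : ℕ) (t : ℝ) : HasDerivAt (Phi1 k) (Phi2 k t) t := by
  unfold Phi1 Phi2
  refine (intervalIntegral.hasDerivAt_integral_of_dominated_loc_of_deriv_le
    (F := fun t θ => -(sin (t * cos θ) * cos θ) * sin θ ^ k)
    (F' := fun t θ => -(cos (t * cos θ) * cos θ * cos θ) * sin θ ^ k)
    (s := Set.univ) (bound := fun _ => 1) Filter.univ_mem ?_ ?_ ?_ ?_ ?_ ?_).2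
  · exact Filter.Eventually.of_forall fun x =>
      (by fun_prop : Continuous
        fun θ => -(sin (x * cos θ) * cos θ) * sin θ ^ k).aestronglyMeasurable
  · exact (by fun_prop : Continuous
      fun θ => -(sin (t * cos θ) * cos θ) * sin θ ^ k).intervalIntegrable _ _
  · exact (by fun_prop :
      Continuous fun θ => -(cos (t * cos θ) * cos θ * cos θ) * sin θ ^ k).aestronglyMeasurable
  · refine Filter.Eventually.of_forall fun θ _ x _ => ?_
    rw [Real.norm_eq_abs, abs_mul, abs_neg, abs_mul, abs_mul]
    exact mul_le_one₀ (mul_le_one₀ (mul_le_one₀ (abs_cos_le_one _) (abs_nonneg _)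
      (abs_cos_le_one _)) (abs_nonneg _) (abs_cos_le_one _))
      (abs_nonneg _) (abs_sin_pow_le k θ)
  · exact intervalIntegrable_const
  · refine Filter.Eventually.of_forall fun θ _ x _ => ?_
    have h1 : HasDerivAt (fun x : ℝ => x * cos θ) (cos θ) x := by
      simpa using (hasDerivAt_id x).mul_const (cos θ)
    have := (((h1.sin).mul_const (cos θ)).neg).mul_const (sin θ ^ k)
    refine this.congr_deriv rfl

lemma Phi_ode_mul (k : ℕ) (t : ℝ) : t * (Phi2 k t + Phi k t) + ((k:ℝ) + 1) * Phi1 k t = 0 := by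
  have hF : ∀ θ ∈ Set.uIcc 0 π, HasDerivAt (fun θ => -(sin (t * cos θ) * sin θ ^ (k+1)))
      (t * (-(cos (t * cos θ) * cos θ * cos θ) * sin θ ^ k + cos (t * cos θ) * sin θ ^ k)
        + ((k:ℝ)+1) * (-(sin (t * cos θ) * cos θ) * sin θ ^ k)) θ := by
    intro θ _
    have h1 := ((hasDerivAt_cos θ).const_mul t).sin
    have h2 := (hasDerivAt_sin θ).pow (k+1)
    have h3 := (h1.mul h2).neg
    refine h3.congr_deriv (Eq.symm ?_)
    have : cos θ * cos θ = 1 - sin θ ^ 2 := by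
      have := sin_sq_add_cos_sq θ; nlinarith
    push_cast
    simp only [Nat.add_sub_cancel, Pi.pow_apply]
    rw [show cos (t * cos θ) * cos θ * cos θ = cos (t * cos θ) * (cos θ * cos θ) by ring, this]
    ring
  have := intervalIntegral.integral_eq_sub_of_hasDerivAt hF
    (by apply Continuous.intervalIntegrable; fun_prop)
  rw [intervalIntegral.integral_add (by apply Continuous.intervalIntegrable; fun_prop)
    (by apply Continuous.intervalIntegrable; fun_prop),
    intervalIntegral.integral_const_mul, intervalIntegral.integral_const_mul,
    intervalIntegral.integral_add (by apply Continuous.intervalIntegrable; fun_prop)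
    (by apply Continuous.intervalIntegrable; fun_prop)] at this
  unfold Phi Phi1 Phi2
  rw [this]
  simp

lemma Phi_zero_pos (k : ℕ) : 0 < Phi k 0 := by
  unfold Phi
  simpa using integral_sin_pow_pos (n := k)

lemma Phi1_zero (k : ℕ) : Phi1 k 0 = 0 := by
  unfold Phi1; simp

lemma Phi_cont (k : ℕ) : Continuous (Phi k) :=
  continuous_iff_continuousAt.2 fun t => (Phi_hasDerivAt k t).continuousAt
lemma Phi1_cont (k : ℕ) : Continuous (Phi1 k) :=
  continuous_iff_continuousAt.2 fun t => (Phi1_hasDerivAt k t).continuousAt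

/-- Positivity before the first zero. -/
lemma pos_of_ne {f : ℝ → ℝ} {b : ℝ} (hf : ContinuousOn f (Set.Icc 0 b)) (h0 : 0 < f 0)
    (hne : ∀ s ∈ Set.Ioo 0 b, f s ≠ 0) : ∀ s ∈ Set.Ico 0 b, 0 < f s := by
  intro s hs
  by_contra hc
  push Not at hc
  have hsub : Set.Icc 0 s ⊆ Set.Icc 0 b := Set.Icc_subset_Icc_right hs.2.le
  obtain ⟨x, hx, hx0⟩ := intermediate_value_Icc' hs.1 (hf.mono hsub) ⟨hc, h0.le⟩
  have hx1 : x ≠ 0 := by rintro rfl; linarith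
  exact hne x ⟨lt_of_le_of_ne hx.1 (Ne.symm hx1), lt_of_le_of_lt hx.2 hs.2⟩ hx0

lemma Phi_exists_zero (k : ℕ) (hk : k ≤ 4) : ∃ t, 0 < t ∧ Phi k t = 0 := by
  by_contra hcon
  push Not at hcon
  have hpos : ∀ s, 0 ≤ s → 0 < Phi k s := fun s hs =>
    pos_of_ne (b := s + 1) (Phi_cont k).continuousOn (Phi_zero_pos k)
      (fun x hx => hcon x hx.1) s ⟨hs, by linarith⟩
  set e : ℝ := ((k:ℝ) + 1) / 2 with he
  have hk' : (k:ℝ) ≤ 4 := by exact_mod_cast hk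
  have hk0 : (0:ℝ) ≤ k := Nat.cast_nonneg k
  set W : ℝ → ℝ := fun s => s ^ e * ((e * Phi k s / s + Phi1 k s) * sin ((s - 4) / 2)
    - Phi k s * (cos ((s - 4) / 2) / 2)) with hW
  have hder : ∀ s, 0 < s → HasDerivAt W (s ^ e * Phi k s * sin ((s - 4) / 2) *
      ((e ^ 2 - e) / s ^ 2 - 3 / 4)) s := by
    intro s hs
    have d0 : HasDerivAt (fun s : ℝ => s ^ e) (e * s ^ (e - 1)) s :=
      Real.hasDerivAt_rpow_const (Or.inl hs.ne')
    have d1 : HasDerivAt (fun s : ℝ => (s - 4) / 2) (1 / 2) s :=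
      ((hasDerivAt_id s).sub_const 4).div_const 2
    have d2 := d1.sin
    have d3 := d1.cos.div_const 2
    have d4 := ((Phi_hasDerivAt k s).const_mul e).div (hasDerivAt_id s) hs.ne'
    have d5 := ((d4.add (Phi1_hasDerivAt k s)).mul d2).sub ((Phi_hasDerivAt k s).mul d3)
    have d6 := d0.mul d5
    refine d6.congr_deriv (Eq.symm ?_)
    have hode := Phi_ode_mul k s
    have h2 : Phi2 k s = - Phi k s - 2 * e * Phi1 k s / s := by
      rw [he]; field_simp; linarith
    simp only [Pi.add_apply, Pi.mul_apply, Pi.sub_apply, Pi.div_apply, id]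
    rw [h2, Real.rpow_sub_one hs.ne']
    field_simp
    ring
  have hpi := Real.pi_pos
  have hanti : StrictAntiOn W (Set.Icc 4 (4 + 2 * π)) := by
    apply strictAntiOn_of_deriv_neg (convex_Icc _ _)
    · intro s hs
      exact (hder s (by linarith [hs.1])).continuousAt.continuousWithinAt
    · intro s hs
      rw [interior_Icc] at hs
      have hs0 : 0 < s := by linarith [hs.1]
      rw [(hder s hs0).deriv]
      apply mul_neg_of_pos_of_neg
      · have := hpos s hs0.le
        have h3 : 0 < sin ((s - 4) / 2) :=
          Real.sin_pos_of_pos_of_lt_pi (by linarith [hs.1]) (by linarith [hs.2])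
        have := Real.rpow_pos_of_pos hs0 e
        positivity
      · rw [sub_neg, div_lt_iff₀ (by positivity)]
        have : e ≤ 5 / 2 := by rw [he]; linarith
        have : 0 ≤ e := by rw [he]; linarith
        nlinarith [hs.1]
  have hlt := hanti (Set.left_mem_Icc.2 (by linarith)) (Set.right_mem_Icc.2 (by linarith))
    (by linarith : (4:ℝ) < 4 + 2 * π)
  have e1 : (4 + 2 * π - 4) / 2 = π := by ring
  simp only [hW, e1, sub_self, zero_div, sin_zero, cos_zero, sin_pi, cos_pi] at hlt
  have p1 := mul_pos (Real.rpow_pos_of_pos (by norm_num : (0:ℝ) < 4) e) (hpos 4 (by norm_num))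
  have p2 := mul_pos (Real.rpow_pos_of_pos (by linarith : (0:ℝ) < 4 + 2 * π) e)
    (hpos (4 + 2 * π) (by linarith))
  nlinarith

lemma Phi_first_zero (k : ℕ) (hk : k ≤ 4) :
    ∃ j, 0 < j ∧ Phi k j = 0 ∧ ∀ s ∈ Set.Ico 0 j, 0 < Phi k s := by
  obtain ⟨T, hT, hT0⟩ := Phi_exists_zero k hk
  have hc : IsCompact (Set.Icc 0 T ∩ {t | Phi k t = 0}) :=
    isCompact_Icc.inter_right (isClosed_eq (Phi_cont k) continuous_const)
  obtain ⟨j, hj, hmin⟩ := hc.exists_isLeast ⟨T, ⟨hT.le, le_rfl⟩, hT0⟩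
  have hj0 : j ≠ 0 := by
    rintro rfl
    exact (Phi_zero_pos k).ne' hj.2
  refine ⟨j, lt_of_le_of_ne hj.1.1 (Ne.symm hj0), hj.2, ?_⟩
  apply pos_of_ne (Phi_cont k).continuousOn (Phi_zero_pos k)
  intro s hs h0
  have := hmin ⟨⟨hs.1.le, hs.2.le.trans hj.1.2⟩, h0⟩
  linarith [hs.2]

/-- Scaled version: `g s = Phi k (c s)`. -/
lemma Phi_scaled (k : ℕ) (c s : ℝ) : HasDerivAt (fun s => Phi k (c * s)) (c * Phi1 k (c * s)) s ∧
    HasDerivAt (fun s => c * Phi1 k (c * s)) (c ^ 2 * Phi2 k (c * s)) s := by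
  have h1 : HasDerivAt (fun s : ℝ => c * s) c s := by
    simpa using (hasDerivAt_id s).const_mul c
  refine ⟨?_, ?_⟩
  · have := (Phi_hasDerivAt k (c * s)).comp s h1
    refine this.congr_deriv (Eq.symm ?_)
    ring
  · have := ((Phi1_hasDerivAt k (c * s)).comp s h1).const_mul c
    refine this.congr_deriv (Eq.symm ?_)
    ring

lemma Phi_scaled_ode (k : ℕ) (c s : ℝ) (hs : s ≠ 0) : c ^ 2 * Phi2 k (c * s) +
    (((k + 1 : ℕ):ℝ) / s) * (c * Phi1 k (c * s)) + c ^ 2 * Phi k (c * s) = 0 := by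
  have := Phi_ode_mul k (c * s)
  push_cast
  field_simp
  linear_combination c * this

lemma wronskian_deriv (n : ℕ) (f f' g g' : ℝ → ℝ) (f2 g2 a b s : ℝ) (hs : 0 < s)
    (hf : HasDerivAt f (f' s) s) (hf' : HasDerivAt f' f2 s)
    (hg : HasDerivAt g (g' s) s) (hg' : HasDerivAt g' g2 s)
    (of : f2 + ((n:ℝ) / s) * f' s + a * f s = 0) (og : g2 + ((n:ℝ) / s) * g' s + b * g s = 0) :
    HasDerivAt (fun s => s ^ n * (f' s * g s - f s * g' s)) (s ^ n * ((b - a) * (f s * g s))) s := by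
  have := (hasDerivAt_pow n s).mul ((hf'.mul hg).sub (hf.mul hg'))
  refine this.congr_deriv (Eq.symm ?_)
  have e1 : f2 = -(((n:ℝ) / s) * f' s + a * f s) := by linarith
  have e2 : g2 = -(((n:ℝ) / s) * g' s + b * g s) := by linarith
  simp only [Pi.mul_apply, Pi.sub_apply]
  rw [e1, e2]
  rcases n with _ | n
  · simp; ring
  · simp only [Nat.add_sub_cancel]
    field_simp
    ring

lemma mu_ge (N k : ℕ) (hN : N = k + 2) (j : ℝ) (hj : 0 < j)
    (hpos : ∀ s ∈ Set.Ico 0 j, 0 < Phi k s) (μ : ℝ) (hμ : IsRadialEigenvalue N μ) : j ^ 2 ≤ μ := by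
  obtain ⟨hμ0, ψ, ψ', ψ'', ⟨x, hx, hxne⟩, h1, h2, ho, hb0, hb1⟩ := hμ
  by_contra hlt
  push Not at hlt
  set c := √μ with hc
  have hc2 : c ^ 2 = μ := Real.sq_sqrt hμ0.le
  have hcj : c < j := by
    rw [hc, Real.sqrt_lt' hj]; exact hlt
  have hc0 : 0 ≤ c := Real.sqrt_nonneg μ
  have gpos : ∀ s ∈ Set.Icc (0:ℝ) 1, 0 < Phi k (c * s) := by
    intro s hs
    refine hpos _ ⟨mul_nonneg hc0 hs.1, ?_⟩
    nlinarith [hs.1, hs.2]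
  have gc : ContinuousOn (fun s => Phi k (c * s)) (Set.Icc 0 1) :=
    ((Phi_cont k).comp (continuous_const.mul continuous_id)).continuousOn
  have gc1 : ContinuousOn (fun s => c * Phi1 k (c * s)) (Set.Icc 0 1) :=
    (continuous_const.mul ((Phi1_cont k).comp (continuous_const.mul continuous_id))).continuousOn
  have pc : ContinuousOn ψ (Set.Icc 0 1) := fun s hs => (h1 s hs).continuousWithinAt
  have pc1 : ContinuousOn ψ' (Set.Icc 0 1) := fun s hs => (h2 s hs).continuousWithinAt
  set W : ℝ → ℝ := fun s => s ^ (k+1) * (ψ' s * Phi k (c * s) - ψ s * (c * Phi1 k (c * s))) with hW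
  have hWc : ContinuousOn W (Set.Icc 0 1) :=
    (continuousOn_id.pow (k+1)).mul ((pc1.mul gc).sub (pc.mul gc1))
  have hWd : ∀ s ∈ Set.Ioo (0:ℝ) 1, HasDerivAt W 0 s := by
    intro s hs
    have hm : Set.Icc (0:ℝ) 1 ∈ 𝓝 s := Icc_mem_nhds hs.1 hs.2
    have hs' := Set.Ioo_subset_Icc_self hs
    have hoo := ho s hs
    rw [hN] at hoo
    have := wronskian_deriv (k+1) ψ ψ' (fun s => Phi k (c * s)) (fun s => c * Phi1 k (c * s))
      (ψ'' s) _ μ (c ^ 2) s hs.1 ((h1 s hs').hasDerivAt hm) ((h2 s hs').hasDerivAt hm)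
      (Phi_scaled k c s).1 (Phi_scaled k c s).2
      (by rw [← hoo]; push_cast; ring) (Phi_scaled_ode k c s hs.1.ne')
    rw [hc2] at this
    simpa using this
  have const_of : ∀ F : ℝ → ℝ, ContinuousOn F (Set.Icc 0 1) →
      (∀ s ∈ Set.Ioo (0:ℝ) 1, HasDerivAt F 0 s) → ∀ s ∈ Set.Icc (0:ℝ) 1, ∀ t ∈ Set.Icc (0:ℝ) 1,
      F s = F t := by
    intro F hF hd s hs t ht
    have hm := monotoneOn_of_deriv_nonneg (convex_Icc (0:ℝ) 1) hF
      (by rw [interior_Icc]; exact fun x hx => (hd x hx).differentiableAt.differentiableWithinAt)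
      (by rw [interior_Icc]; exact fun x hx => (hd x hx).deriv.ge)
    have ha := antitoneOn_of_deriv_nonpos (convex_Icc (0:ℝ) 1) hF
      (by rw [interior_Icc]; exact fun x hx => (hd x hx).differentiableAt.differentiableWithinAt)
      (by rw [interior_Icc]; exact fun x hx => (hd x hx).deriv.le)
    rcases le_total s t with h | h
    · exact le_antisymm (hm hs ht h) (ha hs ht h)
    · exact le_antisymm (ha ht hs h) (hm ht hs h)
  have z0 : (0:ℝ) ∈ Set.Icc (0:ℝ) 1 := by simp
  have z1 : (1:ℝ) ∈ Set.Icc (0:ℝ) 1 := by simp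
  have hW0 : ∀ s ∈ Set.Icc (0:ℝ) 1, W s = 0 := by
    intro s hs
    rw [const_of W hWc hWd s hs 0 z0]
    simp [hW]
  have hq := const_of (fun s => ψ s / Phi k (c * s)) (pc.div gc fun s hs => (gpos s hs).ne')
    (by
      intro s hs
      have hm : Set.Icc (0:ℝ) 1 ∈ 𝓝 s := Icc_mem_nhds hs.1 hs.2
      have hs' := Set.Ioo_subset_Icc_self hs
      have := ((h1 s hs').hasDerivAt hm).div (Phi_scaled k c s).1 (gpos s hs').ne'
      refine this.congr_deriv (Eq.symm ?_)
      have hz := hW0 s hs'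
      simp only [hW, mul_eq_zero] at hz
      have hz := hz.resolve_left (pow_ne_zero _ hs.1.ne')
      rw [hz, zero_div])
    x hx 1 z1
  simp only [hb1, zero_div, div_eq_zero_iff] at hq
  exact (gpos x hx).ne' (hq.resolve_left hxne)

lemma j_eig (N k : ℕ) (hN : N = k + 2) (j : ℝ) (hj : 0 < j) (hz : Phi k j = 0) :
    IsRadialEigenvalue N (j ^ 2) := by
  refine ⟨by positivity, fun s => Phi k (j * s), fun s => j * Phi1 k (j * s),
    fun s => j ^ 2 * Phi2 k (j * s), ⟨0, by simp, ?_⟩, ?_, ?_, ?_, ?_, ?_⟩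
  · simpa using (Phi_zero_pos k).ne'
  · exact fun s _ => (Phi_scaled k j s).1.hasDerivWithinAt
  · exact fun s _ => (Phi_scaled k j s).2.hasDerivWithinAt
  · intro s hs
    have := Phi_scaled_ode k j s hs.1.ne'
    rw [← this, hN]; push_cast; ring
  · simp [Phi1_zero]
  · simpa using hz

lemma upper_general (N k : ℕ) (hN : N = k + 2) (hk : k ≤ 4) (lam : ℝ) (m : ℕ)
    (u u' u'' : ℝ → ℝ) (hu : BNSol N lam m u u' u'')
    (r : ℝ) (hr : IsFirstZero u r) : lam * r ^ 2 < mu1 N := by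
  obtain ⟨⟨hr0, hr1⟩, hur, hne⟩ := hr
  obtain ⟨j, hj, hz, hpos⟩ := Phi_first_zero k hk
  have hmu : j ^ 2 ≤ mu1 N := le_csInf ⟨_, j_eig N k hN j hj hz⟩
    (fun μ hμ => mu_ge N k hN j hj hpos μ hμ)
  refine lt_of_lt_of_le ?_ hmu
  by_contra hle
  push Not at hle
  have hsub : Set.Icc (0:ℝ) r ⊆ Set.Icc 0 1 := Set.Icc_subset_Icc_right hr1
  have uc : ContinuousOn u (Set.Icc 0 r) :=
    fun s hs => ((hu.deriv_fst s (hsub hs)).continuousWithinAt).mono hsub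
  have uc1 : ContinuousOn u' (Set.Icc 0 r) :=
    fun s hs => ((hu.deriv_snd s (hsub hs)).continuousWithinAt).mono hsub
  have upos := pos_of_ne uc hu.pos_zero hne
  set c := j / r with hc
  have gc : ContinuousOn (fun s => Phi k (c * s)) (Set.Icc 0 r) :=
    ((Phi_cont k).comp (continuous_const.mul continuous_id)).continuousOn
  have gc1 : ContinuousOn (fun s => c * Phi1 k (c * s)) (Set.Icc 0 r) :=
    (continuous_const.mul ((Phi1_cont k).comp (continuous_const.mul continuous_id))).continuousOn
  set W : ℝ → ℝ := fun s => s ^ (k+1) * (u' s * Phi k (c * s) - u s * (c * Phi1 k (c * s))) with hW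
  have hcr : c * r = j := by rw [hc]; field_simp
  have hc0 : 0 < c := div_pos hj hr0
  have hcl : c ^ 2 ≤ lam := by
    rw [hc, div_pow, div_le_iff₀ (by positivity)]; exact hle
  have hanti : StrictAntiOn W (Set.Icc 0 r) := by
    apply strictAntiOn_of_deriv_neg (convex_Icc _ _)
    · exact (continuousOn_id.pow (k+1)).mul ((uc1.mul gc).sub (uc.mul gc1))
    · rw [interior_Icc]
      intro s hs
      have hs1 : s ∈ Set.Ioo (0:ℝ) 1 := ⟨hs.1, lt_of_lt_of_le hs.2 hr1⟩
      have hm : Set.Icc (0:ℝ) 1 ∈ 𝓝 s := Icc_mem_nhds hs1.1 hs1.2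
      have hs' := Set.Ioo_subset_Icc_self hs1
      have hoo := hu.ode s hs1
      have up := upos s ⟨hs.1.le, hs.2⟩
      have hd := wronskian_deriv (k+1) u u' (fun s => Phi k (c * s)) (fun s => c * Phi1 k (c * s))
        (u'' s) _ (|u s| ^ ((4:ℝ) / ((N:ℝ) - 2)) + lam) (c ^ 2) s hs.1
        ((hu.deriv_fst s hs').hasDerivAt hm) ((hu.deriv_snd s hs').hasDerivAt hm)
        (Phi_scaled k c s).1 (Phi_scaled k c s).2
        (by rw [← hoo, hN]; push_cast; ring) (Phi_scaled_ode k c s hs.1.ne')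
      rw [hd.deriv]
      have q : 0 < |u s| ^ ((4:ℝ) / ((N:ℝ) - 2)) := Real.rpow_pos_of_pos (abs_pos.2 up.ne') _
      have gp : 0 < Phi k (c * s) := hpos _ ⟨mul_nonneg hc0.le hs.1.le, by
        rw [← hcr]; exact mul_lt_mul_of_pos_left hs.2 hc0⟩
      exact mul_neg_of_pos_of_neg (pow_pos hs.1 _)
        (mul_neg_of_neg_of_pos (by linarith) (mul_pos up gp))
  have := hanti (Set.left_mem_Icc.2 hr0.le) (Set.right_mem_Icc.2 hr0.le) hr0
  simp [hW, hcr, hz, hur] at this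

lemma x_cos_lt_sin {x : ℝ} (h0 : 0 < x) (h1 : x < π) : x * cos x < sin x := by
  have hs := Real.sin_pos_of_pos_of_lt_pi h0 h1
  rcases lt_or_ge x (π / 2) with h | h
  · have hc : 0 < cos x := Real.cos_pos_of_mem_Ioo ⟨by linarith, h⟩
    have := Real.lt_tan h0 h
    rwa [Real.tan_eq_sin_div_cos, lt_div_iff₀ hc] at this
  · have : cos x ≤ 0 := Real.cos_nonpos_of_pi_div_two_le_of_le h (by linarith)
    nlinarith

lemma three_bounds (lam : ℝ) (hlam : 0 < lam) (m : ℕ)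
    (u u' u'' : ℝ → ℝ) (hu : BNSol 3 lam m u u' u'')
    (r : ℝ) (hr : IsFirstZero u r) : π ^ 2 / 4 < lam * r ^ 2 ∧ lam * r ^ 2 < π ^ 2 := by
  obtain ⟨⟨hr0, hr1⟩, hur, hne⟩ := hr
  have hsub : Set.Icc (0:ℝ) r ⊆ Set.Icc 0 1 := Set.Icc_subset_Icc_right hr1
  have uc : ContinuousOn u (Set.Icc 0 r) :=
    fun s hs => ((hu.deriv_fst s (hsub hs)).continuousWithinAt).mono hsub
  have uc1 : ContinuousOn u' (Set.Icc 0 r) :=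
    fun s hs => ((hu.deriv_snd s (hsub hs)).continuousWithinAt).mono hsub
  have upos := pos_of_ne uc hu.pos_zero hne
  have hpi := Real.pi_pos
  have d1 : ∀ s ∈ Set.Ioo 0 r, HasDerivAt u (u' s) s := fun s hs =>
    (hu.deriv_fst s ⟨hs.1.le, hs.2.le.trans hr1⟩).hasDerivAt
      (Icc_mem_nhds hs.1 (lt_of_lt_of_le hs.2 hr1))
  have d2 : ∀ s ∈ Set.Ioo 0 r, HasDerivAt u' (u'' s) s := fun s hs =>
    (hu.deriv_snd s ⟨hs.1.le, hs.2.le.trans hr1⟩).hasDerivAt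
      (Icc_mem_nhds hs.1 (lt_of_lt_of_le hs.2 hr1))
  have ode : ∀ s ∈ Set.Ioo 0 r, s * u'' s = -(2 * u' s + s * u s ^ 5 + s * lam * u s) := by
    intro s hs
    have h := hu.ode s ⟨hs.1, lt_of_lt_of_le hs.2 hr1⟩
    have e4 : (4:ℝ) / (((3:ℕ):ℝ) - 2) = ((4:ℕ):ℝ) := by norm_num
    have hs0 := hs.1.ne'
    rw [e4, Real.rpow_natCast, show |u s| ^ 4 = u s ^ 4 from (by
      rw [← abs_pow]; exact abs_of_nonneg (by positivity))] at h
    push_cast at h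
    field_simp at h
    linear_combination h
  -- v = s u
  have dv : ∀ s ∈ Set.Ioo 0 r, HasDerivAt (fun s => s * u s) (u s + s * u' s) s := by
    intro s hs
    have := (hasDerivAt_id s).mul (d1 s hs)
    refine this.congr_deriv (Eq.symm ?_)
    simp
  have dv' : ∀ s ∈ Set.Ioo 0 r, HasDerivAt (fun s => u s + s * u' s)
      (-(s * u s ^ 5 + lam * (s * u s))) s := by
    intro s hs
    have := (d1 s hs).add ((hasDerivAt_id s).mul (d2 s hs))
    refine this.congr_deriv (Eq.symm ?_)
    simp only [id]
    linear_combination -(ode s hs)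
  have vc : ContinuousOn (fun s => s * u s) (Set.Icc 0 r) := continuousOn_id.mul uc
  have vc1 : ContinuousOn (fun s => u s + s * u' s) (Set.Icc 0 r) := uc.add (continuousOn_id.mul uc1)
  constructor
  · by_contra hle
    push Not at hle
    set ω := 2 * √lam with hω
    have hω0 : 0 < ω := by positivity
    have hω2 : ω ^ 2 = 4 * lam := by rw [hω, mul_pow, Real.sq_sqrt hlam.le]; norm_num
    have hωr : ω * r ≤ π := by
      refine le_of_sq_le_sq ?_ hpi.le
      rw [mul_pow, hω2]; linarith
    set H : ℝ → ℝ := fun s => sin (ω * s) * (u s + s * u' s) ^ 2 / 2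
      - ω * cos (ω * s) * ((s * u s) * (u s + s * u' s)) / 2
      - ω ^ 2 * sin (ω * s) * (s * u s) ^ 2 / 4 + lam * sin (ω * s) * (s * u s) ^ 2 / 2
      + sin (ω * s) * (s ^ 2 * u s ^ 6) / 6 with hH
    have hanti : StrictAntiOn H (Set.Icc 0 r) := by
      apply strictAntiOn_of_deriv_neg (convex_Icc _ _)
      · have c1 : ContinuousOn (fun s => sin (ω * s)) (Set.Icc 0 r) := by fun_prop
        have c2 : ContinuousOn (fun s => cos (ω * s)) (Set.Icc 0 r) := by fun_prop
        fun_prop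
      · rw [interior_Icc]
        intro s hs
        have hl : HasDerivAt (fun s : ℝ => ω * s) ω s := by
          simpa using (hasDerivAt_id s).const_mul ω
        have ds := hl.sin
        have dc := hl.cos
        have A := (ds.mul ((dv' s hs).pow 2)).div_const 2
        have B := ((dc.const_mul ω).mul ((dv s hs).mul (dv' s hs))).div_const 2
        have C := ((ds.const_mul (ω ^ 2)).mul ((dv s hs).pow 2)).div_const 4
        have D := ((ds.const_mul lam).mul ((dv s hs).pow 2)).div_const 2
        have E := (ds.mul ((hasDerivAt_pow 2 s).mul ((d1 s hs).pow 6))).div_const 6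
        have T := (((A.sub B).sub C).add D).add E
        have hd : HasDerivAt H ((2 / 3) * (s * u s ^ 6) *
            (ω * s * cos (ω * s) - sin (ω * s))) s := by
          refine T.congr_deriv (Eq.symm ?_)
          simp only [Pi.pow_apply, Pi.mul_apply]
          push_cast
          have hl2 : lam = ω ^ 2 / 4 := by linarith
          rw [hl2]
          ring
        rw [hd.deriv]
        have up := upos s ⟨hs.1.le, hs.2⟩
        have hx := x_cos_lt_sin (x := ω * s) (mul_pos hω0 hs.1)
          (lt_of_lt_of_le (mul_lt_mul_of_pos_left hs.2 hω0) hωr)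
        have hs0 := hs.1
        exact mul_neg_of_pos_of_neg (by positivity) (by linarith)
    have := hanti (Set.left_mem_Icc.2 hr0.le) (Set.right_mem_Icc.2 hr0.le) hr0
    have hsn : 0 ≤ sin (ω * r) := Real.sin_nonneg_of_nonneg_of_le_pi (by positivity) hωr
    have : 0 ≤ sin (ω * r) * (u r + r * u' r) ^ 2 := by positivity
    simp [hH, hur] at *
    linarith
  · by_contra hle
    push Not at hle
    set c := π / r with hc
    have hcr : c * r = π := by rw [hc]; field_simp
    have hc0 : 0 < c := div_pos hpi hr0
    have hcl : c ^ 2 ≤ lam := by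
      rw [hc, div_pow, div_le_iff₀ (by positivity)]; exact hle
    set W : ℝ → ℝ := fun s => (u s + s * u' s) * sin (c * s) - (s * u s) * (c * cos (c * s)) with hW
    have hanti : StrictAntiOn W (Set.Icc 0 r) := by
      apply strictAntiOn_of_deriv_neg (convex_Icc _ _)
      · have c1 : ContinuousOn (fun s => sin (c * s)) (Set.Icc 0 r) := by fun_prop
        have c2 : ContinuousOn (fun s => cos (c * s)) (Set.Icc 0 r) := by fun_prop
        fun_prop
      · rw [interior_Icc]
        intro s hs
        have hl : HasDerivAt (fun s : ℝ => c * s) c s := by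
          simpa using (hasDerivAt_id s).const_mul c
        have T := ((dv' s hs).mul hl.sin).sub ((dv s hs).mul (hl.cos.const_mul c))
        have hd : HasDerivAt W ((s * u s * sin (c * s)) * (c ^ 2 - lam - u s ^ 4)) s := by
          refine T.congr_deriv (Eq.symm ?_)
          ring
        rw [hd.deriv]
        have up := upos s ⟨hs.1.le, hs.2⟩
        have hs0 := hs.1
        have sp : 0 < sin (c * s) := Real.sin_pos_of_pos_of_lt_pi (by positivity)
          (by rw [← hcr]; exact mul_lt_mul_of_pos_left hs.2 hc0)
        have : 0 < u s ^ 4 := by positivity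
        exact mul_neg_of_pos_of_neg (by positivity) (by linarith)
    have := hanti (Set.left_mem_Icc.2 hr0.le) (Set.right_mem_Icc.2 hr0.le) hr0
    simp [hW, hcr, hur] at this

theorem statement0 (N : ℕ) (hN : N = 3 ∨ N = 4 ∨ N = 5 ∨ N = 6)
    (lam : ℝ) (hlam : 0 < lam) (m : ℕ) (hm : 1 ≤ m)
    (u u' u'' : ℝ → ℝ) (hu : BNSol N lam m u u' u'')
    (r : ℝ) (hr : IsFirstZero u r) :
    ((N = 4 ∨ N = 5 ∨ N = 6) → 0 < lam * r ^ 2 ∧ lam * r ^ 2 < mu1 N) ∧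
    (N = 3 → π ^ 2 / 4 < lam * r ^ 2 ∧ lam * r ^ 2 < π ^ 2) := by
  refine ⟨fun _ => ⟨?_, ?_⟩, ?_⟩
  · have := hr.1.1
    positivity
  · exact upper_general N (N - 2) (by omega) (by omega) lam m u u' u'' hu r hr
  · rintro rfl
    exact three_bounds lam hlam m u u' u'' hu r hr
end

section
/- Let N ∈ {3,4,5,6}, m ≥ 1, λ̄ > 0, and let (λ_n) be a sequence with λ_n → λ̄ and (u_n) radial solutions of the Brezis–Nirenberg problem with m nodal zones for the parameters λ_n, with first zeros r_n, such that u_n(0) → ∞. Then r_n → 0 if N ∈ {4,5,6}, while r_n → π/(2√λ̄) if N = 3. -/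
open Real Set Filter Topology

namespace BN

lemma mvt_le {f f' : ℝ → ℝ} {a b : ℝ} (hab : a ≤ b) (hc : ContinuousOn f (Icc a b))
    (hd : ∀ x ∈ Ioo a b, HasDerivAt f (f' x) x) (h : ∀ x ∈ Ioo a b, 0 ≤ f' x) : f a ≤ f b := by
  rcases hab.eq_or_lt with rfl | hlt
  · exact le_rfl
  obtain ⟨c, hcm, hce⟩ := exists_hasDerivAt_eq_slope f f' hlt hc hd
  have := h c hcm
  rw [hce] at this
  have h2 : 0 < b - a := sub_pos.2 hlt
  have h3 := mul_nonneg this h2.le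
  rw [div_mul_cancel₀ _ h2.ne'] at h3
  linarith

/-- rescaled initial value problem, dimension `D + 2`. -/
structure IVP (D : ℕ) (μ S : ℝ) (φ φ' g w : ℝ → ℝ) : Prop where
  hD : 1 ≤ D
  hμ : 0 < μ
  hS : 0 < S
  c0 : ContinuousOn φ (Icc 0 S)
  c1 : ContinuousOn φ' (Icc 0 S)
  d1 : ∀ ρ ∈ Ioo 0 S, HasDerivAt φ (φ' ρ) ρ
  d2 : ∀ ρ ∈ Ioo 0 S, HasDerivAt φ' (-((D + 1) / ρ * φ' ρ) - g ρ * φ ρ - μ * φ ρ) ρ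
  z0 : φ 0 = 1
  z1 : φ' 0 = 0
  zS : φ S = 0
  pos : ∀ ρ ∈ Ioo 0 S, 0 < φ ρ
  hg : g = fun ρ => (φ ρ) ^ ((4:ℝ) / D)
  hw : w = fun ρ => (φ ρ) ^ (-((2:ℝ) / D))

namespace IVP
variable {D : ℕ} {μ S : ℝ} {φ φ' g w : ℝ → ℝ}

lemma Dpos (h : IVP D μ S φ φ' g w) : (0:ℝ) < D := by
  have := h.hD; exact_mod_cast this

lemma nonneg (h : IVP D μ S φ φ' g w) {ρ : ℝ} (hρ : ρ ∈ Icc 0 S) : 0 ≤ φ ρ := by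
  rcases hρ.1.eq_or_lt with rfl | h1
  · rw [h.z0]; norm_num
  rcases hρ.2.eq_or_lt with rfl | h2
  · rw [h.zS]
  exact (h.pos ρ ⟨h1, h2⟩).le

lemma gnonneg (h : IVP D μ S φ φ' g w) {ρ : ℝ} (hρ : ρ ∈ Icc 0 S) : 0 ≤ g ρ := by
  rw [h.hg]; exact rpow_nonneg (h.nonneg hρ) _

lemma gpos (h : IVP D μ S φ φ' g w) {ρ : ℝ} (hρ : ρ ∈ Ioo 0 S) : 0 < g ρ := by
  rw [h.hg]; exact rpow_pos_of_pos (h.pos ρ hρ) _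

lemma wpos (h : IVP D μ S φ φ' g w) {ρ : ℝ} (hρ : ρ ∈ Ioo 0 S) : 0 < w ρ := by
  rw [h.hw]; exact rpow_pos_of_pos (h.pos ρ hρ) _

lemma gcont (h : IVP D μ S φ φ' g w) : ContinuousOn g (Icc 0 S) := by
  rw [h.hg]
  have := h.Dpos
  exact h.c0.rpow_const (fun x _ => Or.inr (by positivity))

lemma g0 (h : IVP D μ S φ φ' g w) : g 0 = 1 := by
  rw [h.hg]; simp [h.z0]

lemma w0 (h : IVP D μ S φ φ' g w) : w 0 = 1 := by
  rw [h.hw]; simp [h.z0]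

lemma gS (h : IVP D μ S φ φ' g w) : g S = 0 := by
  have := h.Dpos
  rw [h.hg]; simp only [h.zS]; apply zero_rpow; positivity

lemma gd (h : IVP D μ S φ φ' g w) {ρ : ℝ} (hρ : ρ ∈ Ioo 0 S) :
    HasDerivAt g ((4:ℝ) / D * (g ρ / φ ρ) * φ' ρ) ρ := by
  have hp := h.pos ρ hρ
  have := (h.d1 ρ hρ).rpow_const (p := (4:ℝ)/D) (Or.inl hp.ne')
  rw [h.hg]
  convert this using 1
  simp only []
  rw [rpow_sub_one hp.ne']; ring

lemma wd (h : IVP D μ S φ φ' g w) {ρ : ℝ} (hρ : ρ ∈ Ioo 0 S) :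
    HasDerivAt w (-((2:ℝ) / D) * (w ρ / φ ρ) * φ' ρ) ρ := by
  have hp := h.pos ρ hρ
  have := (h.d1 ρ hρ).rpow_const (p := -((2:ℝ)/D)) (Or.inl hp.ne')
  rw [h.hw]
  convert this using 1
  simp only []
  rw [rpow_sub_one hp.ne']; ring

lemma gw (h : IVP D μ S φ φ' g w) {ρ : ℝ} (hρ : ρ ∈ Ioo 0 S) : g ρ * w ρ ^ 2 = 1 := by
  have hp := h.pos ρ hρ
  rw [h.hg, h.hw]
  simp only []
  rw [← rpow_natCast, ← rpow_mul hp.le, ← rpow_add hp]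
  convert rpow_zero (φ ρ) using 2
  push_cast; ring

lemma gphi (h : IVP D μ S φ φ' g w) {ρ : ℝ} (hρ : ρ ∈ Ioo 0 S) : g ρ ^ D = φ ρ ^ 4 := by
  have hp := h.pos ρ hρ
  have := h.Dpos
  rw [h.hg]
  simp only []
  rw [← rpow_natCast, ← rpow_mul hp.le, ← rpow_natCast]
  congr 1
  push_cast; field_simp

/-- flux -/
lemma Fd (h : IVP D μ S φ φ' g w) {ρ : ℝ} (hρ : ρ ∈ Ioo 0 S) :
    HasDerivAt (fun x => -(x ^ (D + 1) * φ' x)) (ρ ^ (D + 1) * (g ρ * φ ρ + μ * φ ρ)) ρ := by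
  have h1 := ((hasDerivAt_pow (D + 1) ρ).mul (h.d2 ρ hρ)).neg
  refine h1.congr_deriv ?_
  have := hρ.1.ne'
  push_cast
  field_simp
  ring

lemma Fc (h : IVP D μ S φ φ' g w) : ContinuousOn (fun x => -(x ^ (D + 1) * φ' x)) (Icc 0 S) :=
  ((continuous_pow _).continuousOn.mul h.c1).neg

lemma Fmono (h : IVP D μ S φ φ' g w) {x y : ℝ} (hx : 0 ≤ x) (hxy : x ≤ y) (hy : y ≤ S) :
    -(x ^ (D + 1) * φ' x) ≤ -(y ^ (D + 1) * φ' y) := by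
  refine mvt_le (f := fun x => -(x ^ (D + 1) * φ' x)) hxy (h.Fc.mono (Icc_subset_Icc hx hy))
    (fun z hz => h.Fd ⟨hx.trans_lt hz.1, hz.2.trans_le hy⟩) (fun z hz => ?_)
  have hz' : z ∈ Ioo 0 S := ⟨hx.trans_lt hz.1, hz.2.trans_le hy⟩
  have := h.pos z hz'
  have := h.gpos hz'
  have := h.hμ
  have := hz'.1
  positivity

lemma dnonpos (h : IVP D μ S φ φ' g w) {ρ : ℝ} (hρ : ρ ∈ Icc 0 S) : φ' ρ ≤ 0 := by
  rcases hρ.1.eq_or_lt with rfl | h1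
  · rw [h.z1]
  have := h.Fmono le_rfl hρ.1 hρ.2
  rw [h.z1] at this
  have hp : 0 < ρ ^ (D + 1) := by positivity
  by_contra hc
  push Not at hc
  have := mul_pos hp hc
  linarith

lemma anti (h : IVP D μ S φ φ' g w) {x y : ℝ} (hx : 0 ≤ x) (hxy : x ≤ y) (hy : y ≤ S) :
    φ y ≤ φ x := by
  have := mvt_le (f := fun x => - φ x) (f' := fun x => - φ' x) hxy
    ((h.c0.mono (Icc_subset_Icc hx hy)).neg)
    (fun z hz => (h.d1 z ⟨hx.trans_lt hz.1, hz.2.trans_le hy⟩).neg) (fun z hz => by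
      have := h.dnonpos (ρ := z) ⟨hx.trans hz.1.le, hz.2.le.trans hy⟩
      linarith)
  linarith

lemma le_one (h : IVP D μ S φ φ' g w) {ρ : ℝ} (hρ : ρ ∈ Icc 0 S) : φ ρ ≤ 1 := by
  rw [← h.z0]; exact h.anti le_rfl hρ.1 hρ.2

lemma gle_one (h : IVP D μ S φ φ' g w) {ρ : ℝ} (hρ : ρ ∈ Icc 0 S) : g ρ ≤ 1 := by
  have := h.Dpos
  rw [h.hg]; exact rpow_le_one (h.nonneg hρ) (h.le_one hρ) (by positivity)

lemma Flow (h : IVP D μ S φ φ' g w) {ρ : ℝ} (hρ : ρ ∈ Icc 0 S) :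
    ρ ^ (D + 2) * (g ρ * φ ρ) / (D + 2) ≤ -(ρ ^ (D + 1) * φ' ρ) := by
  have key := mvt_le (f := fun x => -(x ^ (D + 1) * φ' x) - x ^ (D + 2) * (g x * φ x) / (D + 2))
    (f' := fun x => x ^ (D + 1) * (μ * φ x) - x ^ (D + 2) * ((4 / D + 1) * g x * φ' x) / (D + 2)) hρ.1
    ((h.Fc.sub (((continuous_pow _).continuousOn.mul (h.gcont.mul h.c0)).div_const _)).mono
      (Icc_subset_Icc le_rfl hρ.2)) ?_ ?_
  · simp [h.z1] at key; linarith
  · intro x hx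
    have hx' : x ∈ Ioo 0 S := ⟨hx.1, hx.2.trans_le hρ.2⟩
    have h1 := (h.Fd hx').sub
      (((hasDerivAt_pow (D + 2) x).mul ((h.gd hx').mul (h.d1 x hx'))).div_const ((D:ℝ) + 2))
    refine h1.congr_deriv ?_
    have := h.pos x hx'
    have := h.Dpos
    simp only [Nat.reduceSubDiff, Pi.mul_apply]
    push_cast
    field_simp
    ring
  · intro x hx
    have hx' : x ∈ Ioo 0 S := ⟨hx.1, hx.2.trans_le hρ.2⟩
    have h1 := h.pos x hx'
    have h2 := h.gpos hx'
    have h3 := h.dnonpos ⟨hx'.1.le, hx'.2.le⟩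
    have h4 := h.hμ
    have h5 := hx.1
    have h6 := h.Dpos
    have h7 : x ^ (D + 2) * ((4 / D + 1) * g x * φ' x) / (D + 2) ≤ 0 := by
      apply div_nonpos_of_nonpos_of_nonneg _ (by positivity)
      apply mul_nonpos_of_nonneg_of_nonpos (by positivity)
      exact mul_nonpos_of_nonneg_of_nonpos (by positivity) h3
    have : 0 ≤ x ^ (D + 1) * (μ * φ x) := by positivity
    linarith

/-- Pohozaev functional -/
noncomputable def Poh (D : ℕ) (μ : ℝ) (φ φ' g : ℝ → ℝ) (x : ℝ) : ℝ :=
  x ^ (D + 2) * (φ' x ^ 2 / 2 + D / (2 * (D + 2)) * (g x * φ x ^ 2) + μ * φ x ^ 2 / 2)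
    + D / 2 * (x ^ (D + 1) * (φ x * φ' x))

lemma Pc (h : IVP D μ S φ φ' g w) : ContinuousOn (Poh D μ φ φ' g) (Icc 0 S) := by
  have h0 := h.c0
  have h1 := h.c1
  have h2 := h.gcont
  unfold Poh
  fun_prop

lemma Pd (h : IVP D μ S φ φ' g w) {ρ : ℝ} (hρ : ρ ∈ Ioo 0 S) :
    HasDerivAt (Poh D μ φ φ' g) (μ * (ρ ^ (D + 1) * φ ρ ^ 2)) ρ := by
  have a1 := h.d1 ρ hρ
  have a2 := h.d2 ρ hρ
  have a3 := h.gd hρ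
  have h1 := ((hasDerivAt_pow (D + 2) ρ).mul ((((a2.pow 2).div_const 2).add
    ((a3.mul (a1.pow 2)).const_mul ((D:ℝ) / (2 * (D + 2))))).add
    (((a1.pow 2).const_mul μ).div_const 2))).add
    (((hasDerivAt_pow (D + 1) ρ).mul (a1.mul a2)).const_mul ((D:ℝ) / 2))
  refine h1.congr_deriv ?_
  have := h.pos ρ hρ
  have := h.Dpos
  have := hρ.1
  simp only [Nat.reduceSubDiff, Pi.mul_apply, Pi.add_apply, Pi.pow_apply, Nat.add_sub_cancel]
  push_cast
  field_simp
  ring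

lemma P0 (h : IVP D μ S φ φ' g w) : Poh D μ φ φ' g 0 = 0 := by simp [Poh]

lemma PS (h : IVP D μ S φ φ' g w) : Poh D μ φ φ' g S = S ^ (D + 2) * φ' S ^ 2 / 2 := by
  simp [Poh, h.zS]; ring

lemma Pmono (h : IVP D μ S φ φ' g w) {x y : ℝ} (hx : 0 ≤ x) (hxy : x ≤ y) (hy : y ≤ S) :
    Poh D μ φ φ' g x ≤ Poh D μ φ φ' g y := by
  refine mvt_le hxy (h.Pc.mono (Icc_subset_Icc hx hy))
    (fun z hz => h.Pd ⟨hx.trans_lt hz.1, hz.2.trans_le hy⟩) (fun z hz => ?_)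
  have := h.hμ
  have : 0 < z := hx.trans_lt hz.1
  positivity

lemma Plow (h : IVP D μ S φ φ' g w) {ρ : ℝ} (hρ : ρ ∈ Icc 0 S) :
    μ * (ρ ^ (D + 2) * φ ρ ^ 2) / (D + 2) ≤ Poh D μ φ φ' g ρ := by
  have key := mvt_le (f := fun x => Poh D μ φ φ' g x - μ * (x ^ (D + 2) * φ x ^ 2) / (D + 2))
    (f' := fun x => - (2 * μ * (x ^ (D + 2) * φ x) * φ' x / (D + 2))) hρ.1
    ((h.Pc.sub ((((continuous_pow _).continuousOn.mul (h.c0.pow 2)).const_smul μ).div_const _)).mono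
      (Icc_subset_Icc le_rfl hρ.2)) ?_ ?_
  · simp [h.P0] at key; linarith
  · intro x hx
    have hx' : x ∈ Ioo 0 S := ⟨hx.1, hx.2.trans_le hρ.2⟩
    have h1 := (h.Pd hx').sub
      ((((hasDerivAt_pow (D + 2) x).mul ((h.d1 x hx').pow 2)).const_mul μ).div_const ((D:ℝ) + 2))
    refine h1.congr_deriv ?_
    have := h.Dpos
    simp only [Nat.reduceSubDiff, Pi.mul_apply, Pi.pow_apply]
    push_cast
    field_simp
    ring
  · intro x hx
    have hx' : x ∈ Ioo 0 S := ⟨hx.1, hx.2.trans_le hρ.2⟩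
    have h1 := h.pos x hx'
    have h3 := h.dnonpos ⟨hx'.1.le, hx'.2.le⟩
    have h4 := h.hμ
    have h5 := hx.1
    have h6 := h.Dpos
    have h7 : 2 * μ * (x ^ (D + 2) * φ x) * φ' x / (D + 2) ≤ 0 := by
      apply div_nonpos_of_nonpos_of_nonneg _ (by positivity)
      exact mul_nonpos_of_nonneg_of_nonpos (by positivity) h3
    linarith

/-- the monotone quotient -/
noncomputable def Hq (φ φ' w : ℝ → ℝ) (x : ℝ) : ℝ := w x * -φ' x / (φ x * x)

lemma Hmono (h : IVP D μ S φ φ' g w) {x y : ℝ} (hx : 0 < x) (hxy : x ≤ y) (hy : y < S) :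
    Hq φ φ' w x ≤ Hq φ φ' w y := by
  have hd : ∀ z ∈ Ioo 0 S, HasDerivAt (Hq φ φ' w)
      (w z / (φ z ^ 2 * z) * (2 * (D + 2) / D / z ^ (D + 2) *
        (Poh D μ φ φ' g z - μ * (z ^ (D + 2) * φ z ^ 2) / (D + 2)))) z := by
    intro z hz
    have h1 := ((h.wd hz).mul (h.d2 z hz).neg).div ((h.d1 z hz).mul (hasDerivAt_id z))
      (mul_pos (h.pos z hz) hz.1).ne'
    refine h1.congr_deriv ?_
    have := h.pos z hz
    have := h.Dpos
    have := hz.1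
    simp only [Pi.mul_apply, Pi.neg_apply, id, Poh]
    field_simp
    ring
  refine mvt_le hxy (fun z hz => (hd z ⟨hx.trans_le hz.1, hz.2.trans_lt hy⟩).continuousAt.continuousWithinAt)
    (fun z hz => hd z ⟨hx.trans hz.1, hz.2.trans hy⟩) (fun z hz => ?_)
  have hz' : z ∈ Ioo 0 S := ⟨hx.trans hz.1, hz.2.trans hy⟩
  have h1 := h.pos z hz'
  have h2 := h.wpos hz'
  have h6 := h.Dpos
  have h7 := hz'.1
  have h8 := h.Plow ⟨hz'.1.le, hz'.2.le⟩
  have h9 := sub_nonneg.2 h8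
  positivity

lemma Hlow (h : IVP D μ S φ φ' g w) {y : ℝ} (hy : y ∈ Ioo 0 S) :
    1 / ((D:ℝ) + 2) ≤ Hq φ φ' w y := by
  have hD := h.Dpos
  have hc : Tendsto (fun x => w x * g x / ((D:ℝ) + 2)) (𝓝[>] 0) (𝓝 (1 * 1 / ((D:ℝ) + 2))) := by
    have hle : 𝓝[>] (0:ℝ) ≤ 𝓝[Icc 0 S] 0 := by
      rw [← nhdsWithin_Ioo_eq_nhdsGT h.hS]
      exact nhdsWithin_mono _ Ioo_subset_Icc_self
    have hg : Tendsto g (𝓝[>] 0) (𝓝 1) := by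
      have := (h.gcont 0 ⟨le_rfl, h.hS.le⟩).tendsto
      rw [h.g0] at this
      exact this.mono_left hle
    have hφ : Tendsto φ (𝓝[>] 0) (𝓝 1) := by
      have := (h.c0 0 ⟨le_rfl, h.hS.le⟩).tendsto
      rw [h.z0] at this
      exact this.mono_left hle
    have hw : Tendsto w (𝓝[>] 0) (𝓝 1) := by
      have := hφ.rpow_const (p := -((2:ℝ)/D)) (Or.inl one_ne_zero)
      rw [one_rpow] at this
      rw [h.hw]; exact this
    exact (hw.mul hg).div_const _
  rw [mul_one] at hc
  refine le_of_tendsto hc ?_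
  filter_upwards [Ioo_mem_nhdsGT hy.1] with x hx
  have hx' : x ∈ Ioo 0 S := ⟨hx.1, hx.2.trans hy.2⟩
  refine le_trans ?_ (h.Hmono hx.1 hx.2.le hy.2)
  have h1 := h.Flow ⟨hx'.1.le, hx'.2.le⟩
  have h2 := h.pos x hx'
  have h3 := h.wpos hx'
  have h4 := hx.1
  unfold Hq
  rw [le_div_iff₀ (by positivity)]
  have h5 : x ^ (D + 1) * (x * (g x * φ x) / (D + 2)) ≤ x ^ (D + 1) * (- φ' x) := by
    calc _ = x ^ (D + 2) * (g x * φ x) / (D + 2) := by ring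
      _ ≤ _ := h1
      _ = _ := by ring
  have h6 := le_of_mul_le_mul_left h5 (by positivity)
  calc _ = w x * (x * (g x * φ x) / (D + 2)) := by ring
    _ ≤ _ := mul_le_mul_of_nonneg_left h6 h3.le

lemma wlow (h : IVP D μ S φ φ' g w) {y : ℝ} (hy : y ∈ Ioo 0 S) :
    1 + y ^ 2 / ((D:ℝ) * (D + 2)) ≤ w y := by
  have hD := h.Dpos
  have hwc : ContinuousOn w (Icc 0 y) := by
    rw [h.hw]
    refine (h.c0.mono (Icc_subset_Icc le_rfl hy.2.le)).rpow_const (fun x hx => Or.inl ?_)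
    rcases hx.1.eq_or_lt with rfl | h1
    · rw [h.z0]; norm_num
    · exact (h.pos x ⟨h1, hx.2.trans_lt hy.2⟩).ne'
  have key := mvt_le (f := fun x => w x - x ^ 2 / ((D:ℝ) * (D + 2)))
    (f' := fun x => 2 * x / D * (Hq φ φ' w x - 1 / (D + 2))) hy.1.le
    (hwc.sub (by fun_prop)) ?_ ?_
  · simp [h.w0] at key; linarith
  · intro x hx
    have hx' : x ∈ Ioo 0 S := ⟨hx.1, hx.2.trans hy.2⟩
    have h1 := (h.wd hx').sub ((hasDerivAt_pow 2 x).div_const ((D:ℝ) * (D + 2)))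
    refine h1.congr_deriv ?_
    have := h.pos x hx'
    have := hx.1
    unfold Hq
    push_cast
    field_simp
  · intro x hx
    have hx' : x ∈ Ioo 0 S := ⟨hx.1, hx.2.trans hy.2⟩
    have h1 := sub_nonneg.2 (h.Hlow hx')
    have := hx.1
    positivity

lemma gup (h : IVP D μ S φ φ' g w) {y : ℝ} (hy : y ∈ Ioo 0 S) :
    g y * (1 + y ^ 2 / ((D:ℝ) * (D + 2))) ^ 2 ≤ 1 := by
  have hD := h.Dpos
  have h1 := h.wlow hy
  have h2 := h.gpos hy
  calc _ ≤ g y * w y ^ 2 := by gcongr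
    _ = 1 := h.gw hy

lemma gup4 (h : IVP D μ S φ φ' g w) {y : ℝ} (hy : y ∈ Ioo 0 S) :
    g y * y ^ 4 ≤ ((D:ℝ) * (D + 2)) ^ 2 := by
  have hD := h.Dpos
  have h1 := h.gup hy
  have h2 := h.gpos hy
  have h3 : g y * (y ^ 2 / ((D:ℝ) * (D + 2))) ^ 2 ≤ 1 := by
    refine le_trans ?_ h1
    gcongr
    linarith
  rw [div_pow, ← mul_div_assoc, div_le_one (by positivity)] at h3
  calc _ = g y * (y ^ 2) ^ 2 := by ring
    _ ≤ _ := h3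

lemma phiup (h : IVP D μ S φ φ' g w) {y : ℝ} (hy : y ∈ Icc 0 S) :
    φ y * y ^ D ≤ ((D:ℝ) * (D + 2)) ^ D := by
  have hD := h.Dpos
  have hD1 : (1:ℝ) ≤ D := by exact_mod_cast h.hD
  rcases hy.1.eq_or_lt with rfl | h1
  · rw [zero_pow (by have := h.hD; omega)]; simp; positivity
  rcases hy.2.eq_or_lt with rfl | h2
  · rw [h.zS]; simp; positivity
  have hy' : y ∈ Ioo 0 S := ⟨h1, h2⟩
  have h3 := h.gup4 hy'
  have h4 : (φ y * y ^ D) ^ 4 ≤ (((D:ℝ) * (D + 2)) ^ D) ^ 4 := by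
    calc (φ y * y ^ D) ^ 4 = (g y * y ^ 4) ^ D := by
          rw [mul_pow, ← h.gphi hy', mul_pow]; congr 1; rw [← pow_mul, ← pow_mul, mul_comm]
      _ ≤ (((D:ℝ) * (D + 2)) ^ 2) ^ D := by
          apply pow_le_pow_left₀ _ h3
          have := h.gpos hy'; positivity
      _ = (((D:ℝ) * (D + 2)) ^ D) ^ 2 := by rw [← pow_mul, ← pow_mul, mul_comm 2 D]
      _ ≤ _ := by
          apply pow_le_pow_right₀ _ (by norm_num)
          apply one_le_pow₀
          nlinarith
  exact le_of_pow_le_pow_left₀ (by norm_num) (by positivity) h4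

lemma Fup (h : IVP D μ S φ φ' g w) {y : ℝ} (hy : y ∈ Icc 0 S) :
    -(y ^ (D + 1) * φ' y) ≤ ((D:ℝ) * (D + 2)) ^ D * ((D:ℝ) * (D + 2) / 2 + μ * y ^ 2 / 2) := by
  have hD := h.Dpos
  set K : ℝ := (D:ℝ) * (D + 2) with hK
  have hKpos : 0 < K := by positivity
  have key := mvt_le (f := fun x => K ^ D * (-(K / 2) * (1 + x ^ 2 / K)⁻¹ + μ * x ^ 2 / 2) - -(x ^ (D + 1) * φ' x))
    (f' := fun x => K ^ D * (x * ((1 + x ^ 2 / K) ^ 2)⁻¹ + μ * x) - x ^ (D + 1) * (g x * φ x + μ * φ x)) hy.1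
    ((ContinuousOn.sub (by
      apply Continuous.continuousOn
      have : ∀ x : ℝ, 1 + x ^ 2 / K ≠ 0 := fun x => by positivity
      fun_prop (disch := assumption)) h.Fc).mono (Icc_subset_Icc le_rfl hy.2)) ?_ ?_
  · simp [h.z1] at key
    have : 0 ≤ K ^ D * ((K / 2) * (1 + y ^ 2 / K)⁻¹) := by positivity
    nlinarith
  · intro x hx
    have hx' : x ∈ Ioo 0 S := ⟨hx.1, hx.2.trans_le hy.2⟩
    have hne : 1 + x ^ 2 / K ≠ 0 := by positivity
    have h1 := ((((((hasDerivAt_pow 2 x).div_const K).const_add 1).inv hne).const_mul (-(K / 2))).add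
      (((hasDerivAt_pow 2 x).const_mul μ).div_const 2)).const_mul (K ^ D)
    refine (h1.sub (h.Fd hx')).congr_deriv ?_
    push_cast
    field_simp
  · intro x hx
    have hx' : x ∈ Ioo 0 S := ⟨hx.1, hx.2.trans_le hy.2⟩
    have h1 := h.phiup ⟨hx'.1.le, hx'.2.le⟩
    have h2 := h.gup hx'
    rw [← hK] at h1 h2
    have hx0 := hx.1
    have hμ := h.hμ
    have h3 : g x ≤ ((1 + x ^ 2 / K) ^ 2)⁻¹ := by
      rw [le_inv_comm₀ (h.gpos hx') (by positivity), le_inv_comm₀ (by positivity) (h.gpos hx')]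
      rw [← one_div, le_div_iff₀ (by positivity)]; exact h2
    have h4 := h.gpos hx'
    have : x ^ (D + 1) * (g x * φ x + μ * φ x) ≤ K ^ D * (x * ((1 + x ^ 2 / K) ^ 2)⁻¹ + μ * x) := by
      calc _ = (φ x * x ^ D) * (x * g x + μ * x) := by ring
        _ ≤ K ^ D * (x * ((1 + x ^ 2 / K) ^ 2)⁻¹ + μ * x) := by gcongr
    linarith

lemma philow (h : IVP D μ S φ φ' g w) (hμ1 : μ ≤ 1) {y : ℝ} (hy : y ∈ Icc 0 S) :
    1 - y ^ 2 / (D + 2) ≤ φ y := by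
  have hD := h.Dpos
  have hF : ∀ z ∈ Ioo 0 S, - φ' z ≤ 2 * z / (D + 2) := by
    intro z hz
    have key := mvt_le (f := fun x => 2 * x ^ (D + 2) / (D + 2) - -(x ^ (D + 1) * φ' x))
      (f' := fun x => 2 * x ^ (D + 1) - x ^ (D + 1) * (g x * φ x + μ * φ x)) hz.1.le
      ((ContinuousOn.sub (by fun_prop) h.Fc).mono (Icc_subset_Icc le_rfl hz.2.le)) ?_ ?_
    · simp [h.z1] at key
      have hz0 := hz.1
      have : z ^ (D + 1) * (- φ' z) ≤ z ^ (D + 1) * (2 * z / (D + 2)) := by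
        calc _ ≤ 2 * z ^ (D + 2) / (D + 2) := by linarith
          _ = _ := by ring
      exact le_of_mul_le_mul_left this (by positivity)
    · intro x hx
      have hx' : x ∈ Ioo 0 S := ⟨hx.1, hx.2.trans hz.2⟩
      refine ((((hasDerivAt_pow (D + 2) x).const_mul 2).div_const ((D:ℝ) + 2)).sub
        (h.Fd hx')).congr_deriv ?_
      simp only [Nat.reduceSubDiff]
      push_cast
      field_simp
    · intro x hx
      have hx' : x ∈ Icc 0 S := ⟨hx.1.le, (hx.2.trans hz.2).le⟩
      have h1 := h.le_one hx'
      have h2 := h.gle_one hx'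
      have h3 := h.nonneg hx'
      have h4 := h.gnonneg hx'
      have h5 : g x * φ x + μ * φ x ≤ 2 := by nlinarith [h.hμ]
      have h6 : 0 < x ^ (D + 1) := by have := hx.1; positivity
      nlinarith
  have key := mvt_le (f := fun x => φ x + x ^ 2 / (D + 2))
      (f' := fun x => φ' x + 2 * x / (D + 2)) hy.1
      ((ContinuousOn.add h.c0 (by fun_prop)).mono (Icc_subset_Icc le_rfl hy.2)) ?_ ?_
  · simp [h.z0] at key; linarith
  · intro x hx
    refine ((h.d1 x ⟨hx.1, hx.2.trans_le hy.2⟩).add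
      ((hasDerivAt_pow 2 x).div_const ((D:ℝ) + 2))).congr_deriv ?_
    norm_num
  · intro x hx
    have := hF x ⟨hx.1, hx.2.trans_le hy.2⟩
    linarith

lemma phi1 (h : IVP D μ S φ φ' g w) (hμ1 : μ ≤ 1) (hS1 : 1 ≤ S) : 2 / 3 ≤ φ 1 := by
  have h1 := h.philow hμ1 (y := 1) ⟨by norm_num, hS1⟩
  have hD1 : (1:ℝ) ≤ D := by exact_mod_cast h.hD
  have : (1:ℝ) ^ 2 / (D + 2) ≤ 1 / 3 := by
    rw [div_le_div_iff₀ (by positivity) (by norm_num)]; linarith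
  linarith

/-- lower bound for the flux beyond radius one -/
lemma Flow1 (h : IVP D μ S φ φ' g w) (hμ1 : μ ≤ 1) {y : ℝ} (hy : y ∈ Icc 1 S) :
    (2 / 3) ^ 5 / ((D:ℝ) + 2) ≤ -(y ^ (D + 1) * φ' y) := by
  have hS1 : 1 ≤ S := hy.1.trans hy.2
  have hD1 : (1:ℝ) ≤ D := by exact_mod_cast h.hD
  have h0 := h.phi1 hμ1 hS1
  refine le_trans ?_ ((h.Flow (ρ := 1) ⟨by norm_num, hS1⟩).trans (h.Fmono (by norm_num) hy.1 hy.2))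
  have hg : (2 / 3 : ℝ) ^ 4 ≤ g 1 := by
    rw [h.hg]
    simp only []
    calc (2 / 3 : ℝ) ^ 4 = (2 / 3 : ℝ) ^ (4:ℝ) := by norm_cast
      _ ≤ (2 / 3 : ℝ) ^ ((4:ℝ) / D) := by
        apply rpow_le_rpow_of_exponent_ge (by norm_num) (by norm_num)
        rw [div_le_iff₀ (by positivity)]; linarith
      _ ≤ _ := rpow_le_rpow (by norm_num) h0 (by positivity)
  rw [one_pow, one_mul]
  gcongr
  calc (2 / 3 : ℝ) ^ 5 = (2 / 3) ^ 4 * (2 / 3) := by norm_num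
    _ ≤ _ := by gcongr

end IVP
end BN

namespace BN
namespace IVP
variable {D : ℕ} {μ S : ℝ} {φ φ' g w : ℝ → ℝ}

lemma one_le_S (h : IVP D μ S φ φ' g w) (hμ1 : μ ≤ 1) : 1 ≤ S := by
  have h1 := h.philow hμ1 (y := S) ⟨h.hS.le, le_rfl⟩
  rw [h.zS] at h1
  have hD := h.Dpos
  have h2 : 1 ≤ S ^ 2 / ((D:ℝ) + 2) := by linarith
  rw [le_div_iff₀ (by positivity)] at h2
  have := h.hS
  nlinarith

lemma FS_up (h : IVP D μ S φ φ' g w) {M : ℝ} (hM : μ * S ^ 2 ≤ M) :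
    S ^ D * Poh D μ φ φ' g S ≤
      (((D:ℝ) * (D + 2)) ^ D * ((D:ℝ) * (D + 2) / 2 + M / 2)) ^ 2 / 2 := by
  have hS := h.hS
  have hD := h.Dpos
  have h1 := h.Fup (y := S) ⟨hS.le, le_rfl⟩
  have h0 : 0 ≤ -(S ^ (D + 1) * φ' S) := by
    have := h.dnonpos (ρ := S) ⟨hS.le, le_rfl⟩
    have : 0 ≤ S ^ (D + 1) * (- φ' S) := mul_nonneg (by positivity) (by linarith)
    linarith
  have h2 : -(S ^ (D + 1) * φ' S) ≤ ((D:ℝ) * (D + 2)) ^ D * ((D:ℝ) * (D + 2) / 2 + M / 2) := by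
    refine h1.trans ?_
    gcongr
  rw [h.PS]
  calc _ = (-(S ^ (D + 1) * φ' S)) ^ 2 / 2 := by ring
    _ ≤ _ := by gcongr

lemma high (h : IVP D μ S φ φ' g w) (hD3 : 3 ≤ D) (hμ1 : μ ≤ 1) {M : ℝ} (hM : μ * S ^ 2 ≤ M) :
    μ * S ^ 2 * S ≤ (((D:ℝ) * (D + 2)) ^ D * ((D:ℝ) * (D + 2) / 2 + M / 2)) ^ 2 / 2 *
      (9 / 4 * (D + 2)) := by
  have hS := h.one_le_S hμ1
  have hD := h.Dpos
  have hμ := h.hμ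
  have h1 := h.FS_up hM
  have h2 := (h.Plow (ρ := 1) ⟨by norm_num, hS⟩).trans (h.Pmono (by norm_num) hS le_rfl)
  have h3 := h.phi1 hμ1 hS
  have h4 : μ * (4 / 9) / (D + 2) ≤ Poh D μ φ φ' g S := by
    refine le_trans ?_ h2
    gcongr
    rw [one_pow, one_mul]; nlinarith
  have h5 : S ^ D * (μ * (4 / 9) / (D + 2)) ≤ (((D:ℝ) * (D + 2)) ^ D * ((D:ℝ) * (D + 2) / 2 + M / 2)) ^ 2 / 2 :=
    le_trans (by gcongr) h1
  have h6 : S ^ 3 ≤ S ^ D := pow_le_pow_right₀ hS hD3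
  calc μ * S ^ 2 * S = S ^ 3 * μ := by ring
    _ ≤ S ^ D * μ := by gcongr
    _ = S ^ D * (μ * (4 / 9) / (D + 2)) * (9 / 4 * (D + 2)) := by field_simp
    _ ≤ _ := by gcongr

lemma four (h : IVP 2 μ S φ φ' g w) (hμ1 : μ ≤ 1) (hS2 : 2 ≤ S) {c : ℝ}
    (hc : c = (2 / 3) ^ 5 / 4) :
    S ^ 2 * (μ * (9 * c ^ 2 / 64 * Real.log (S / 2))) ≤ S ^ 2 * Poh 2 μ φ φ' g S := by
  have hμ := h.hμ
  have hc0 : 0 < c := by rw [hc]; positivity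
  have hF : ∀ y ∈ Icc 1 S, c ≤ -(y ^ 3 * φ' y) := by
    intro y hy
    have := h.Flow1 hμ1 hy
    norm_num at this
    rw [hc]; norm_num; exact this
  have hφ : ∀ y ∈ Icc 1 (S / 2), 3 * c / 8 / y ^ 2 ≤ φ y := by
    intro y hy
    have hy0 : 0 < y := by linarith [hy.1]
    have hyS : y ≤ S := by linarith [hy.2]
    have key := mvt_le (f := fun x => c / 2 * (x ^ 2)⁻¹ - φ x)
      (f' := fun x => (-(x ^ 3 * φ' x) - c) / x ^ 3) (a := y) (b := S) hyS ?_ ?_ ?_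
    · simp only [h.zS] at key
      have e1 : (S ^ 2)⁻¹ ≤ ((2 * y) ^ 2)⁻¹ := by
        gcongr; linarith [hy.2]
      have e2 : ((2 * y) ^ 2)⁻¹ = (y ^ 2)⁻¹ / 4 := by rw [mul_pow, mul_inv]; ring
      rw [e2] at e1
      rw [div_eq_mul_inv _ (y ^ 2)]
      nlinarith
    · refine ContinuousOn.sub ?_ (h.c0.mono (Icc_subset_Icc hy0.le le_rfl))
      refine continuousOn_const.mul (ContinuousOn.inv₀ (by fun_prop) ?_)
      intro x hx
      have : 0 < x := hy0.trans_le hx.1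
      positivity
    · intro x hx
      have hx0 : 0 < x := hy0.trans hx.1
      refine ((((hasDerivAt_pow 2 x).inv (by positivity)).const_mul (c / 2)).sub
        (h.d1 x ⟨hx0, hx.2⟩)).congr_deriv ?_
      push_cast
      field_simp
      ring
    · intro x hx
      have hx0 : 0 < x := hy0.trans hx.1
      have := hF x ⟨hy.1.trans hx.1.le, hx.2.le⟩
      exact div_nonneg (by linarith) (by positivity)
  have key := mvt_le (f := fun x => Poh 2 μ φ φ' g x - μ * (9 * c ^ 2 / 64) * Real.log x)
    (f' := fun x => μ * (x ^ 3 * φ x ^ 2) - μ * (9 * c ^ 2 / 64) * x⁻¹) (a := 1) (b := S / 2)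
    (by linarith) ?_ ?_ ?_
  · simp only [Real.log_one] at key
    have h1 := (h.Pmono le_rfl (zero_le_one) (by linarith : (1:ℝ) ≤ S))
    rw [h.P0] at h1
    have h2 := h.Pmono (by linarith : 0 ≤ S / 2) (by linarith) le_rfl
    gcongr
    nlinarith
  · refine ContinuousOn.sub (h.Pc.mono (Icc_subset_Icc (by norm_num) (by linarith))) ?_
    refine continuousOn_const.mul (Real.continuousOn_log.mono ?_)
    intro x hx
    have : 0 < x := zero_lt_one.trans_le hx.1
    exact this.ne'
  · intro x hx
    have hx0 : 0 < x := by linarith [hx.1]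
    exact (h.Pd ⟨hx0, by linarith [hx.2]⟩).sub ((Real.hasDerivAt_log hx0.ne').const_mul _)
  · intro x hx
    have hx0 : 0 < x := by linarith [hx.1]
    have h1 := hφ x ⟨hx.1.le, hx.2.le⟩
    have h2 : (3 * c / 8 / x ^ 2) ^ 2 ≤ φ x ^ 2 := by gcongr
    have h3 : μ * (9 * c ^ 2 / 64) * x⁻¹ = μ * (x ^ 3 * (3 * c / 8 / x ^ 2) ^ 2) := by
      field_simp; norm_num
    rw [h3, sub_nonneg]
    gcongr

lemma high_all (D : ℕ) (hD : 2 ≤ D) (M : ℝ) : ∃ C : ℝ, ∀ (μ S : ℝ) (φ φ' g w : ℝ → ℝ),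
    IVP D μ S φ φ' g w → μ ≤ 1 → 2 ≤ S → μ * S ^ 2 ≤ M → μ * S ^ 2 * Real.log (S / 2) ≤ C := by
  rcases hD.eq_or_lt with rfl | hD3
  · set c : ℝ := (2 / 3) ^ 5 / 4 with hc
    refine ⟨((((2:ℕ):ℝ) * ((2:ℕ) + 2)) ^ 2 * (((2:ℕ):ℝ) * ((2:ℕ) + 2) / 2 + M / 2)) ^ 2 / 2 / (9 * c ^ 2 / 64), ?_⟩
    intro μ S φ φ' g w h hμ1 hS hM
    have h1 := (h.four hμ1 hS hc).trans (h.FS_up hM)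
    have hcp : 0 < 9 * c ^ 2 / 64 := by rw [hc]; positivity
    rw [le_div_iff₀ hcp]
    calc _ = S ^ 2 * (μ * (9 * c ^ 2 / 64 * Real.log (S / 2))) := by ring
      _ ≤ _ := h1
  · refine ⟨_, fun μ S φ φ' g w h hμ1 hS hM => le_trans ?_ (h.high hD3 hμ1 hM)⟩
    have := Real.log_le_self (x := S / 2) (by linarith)
    have hμ := h.hμ
    gcongr
    linarith

/-! dimension three -/

lemma V_up (h : IVP 1 μ S φ φ' g w) {y : ℝ} (hy : y ∈ Icc 0 S) : y * φ y ≤ 3 := by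
  have := h.phiup hy
  norm_num at this
  linarith

lemma P_up (h : IVP 1 μ S φ φ' g w) {y : ℝ} (hy : y ∈ Icc 0 S) :
    Poh 1 μ φ φ' g y ≤ 9 * μ * y := by
  have hμ := h.hμ
  have key := mvt_le (f := fun x => 9 * μ * x - Poh 1 μ φ φ' g x)
    (f' := fun x => 9 * μ - μ * (x ^ (1 + 1) * φ x ^ 2)) hy.1
    ((ContinuousOn.sub (by fun_prop) h.Pc).mono (Icc_subset_Icc le_rfl hy.2)) ?_ ?_
  · simp only [h.P0] at key; linarith
  · intro x hx
    refine (((hasDerivAt_id x).const_mul (9 * μ)).sub (h.Pd ⟨hx.1, hx.2.trans_le hy.2⟩)).congr_deriv ?_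
    ring
  · intro x hx
    have hx' : x ∈ Icc 0 S := ⟨hx.1.le, (hx.2.trans_le hy.2).le⟩
    have h1 := h.V_up hx'
    have h2 : 0 ≤ x * φ x := mul_nonneg hx'.1 (h.nonneg hx')
    have h3 : (x * φ x) ^ 2 ≤ 9 := by nlinarith
    have : x ^ (1 + 1) * φ x ^ 2 = (x * φ x) ^ 2 := by ring
    rw [this]; nlinarith

lemma gup9 (h : IVP 1 μ S φ φ' g w) {y : ℝ} (hy : y ∈ Icc 0 S) : g y * y ^ 4 ≤ 9 := by
  rcases hy.1.eq_or_lt with rfl | h1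
  · norm_num
  rcases hy.2.eq_or_lt with rfl | h2
  · rw [h.gS]; norm_num
  have := h.gup4 ⟨h1, h2⟩
  norm_num at this
  exact this

lemma V'_up (h : IVP 1 μ S φ φ' g w) (hμ1 : μ ≤ 1) {c : ℝ} (hc : c = (2 / 3) ^ 5 / 3) {y : ℝ}
    (hy : y ∈ Icc 1 S) : |φ y + y * φ' y| * c ≤ 27 * (μ * y + (y ^ 3)⁻¹) := by
  have hy' : y ∈ Icc 0 S := ⟨zero_le_one.trans hy.1, hy.2⟩
  have hy0 : 0 < y := zero_lt_one.trans_le hy.1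
  have hμ := h.hμ
  have hF : c ≤ -(y ^ 2 * φ' y) := by
    have := h.Flow1 hμ1 hy
    norm_num at this
    rw [hc]; norm_num; exact this
  have e : (φ y + y * φ' y) * -(y ^ 2 * φ' y) = - 2 * Poh 1 μ φ φ' g y
      + y ^ 3 * (g y * φ y ^ 2) / 3 + μ * y * (y * φ y) ^ 2 := by
    unfold Poh; push_cast; ring
  have hV := h.V_up hy'
  have hV0 : 0 ≤ y * φ y := mul_nonneg hy'.1 (h.nonneg hy')
  have hV2 : (y * φ y) ^ 2 ≤ 9 := by nlinarith
  have hP := h.P_up hy'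
  have hP0 := h.Pmono le_rfl hy'.1 hy'.2
  rw [h.P0] at hP0
  have hg := h.gup9 hy'
  have hg0 := h.gnonneg hy'
  have hA : y ^ 3 * (g y * φ y ^ 2) ≤ 81 * (y ^ 3)⁻¹ := by
    rw [← div_eq_mul_inv, le_div_iff₀ (by positivity)]
    calc _ = (g y * y ^ 4) * (y * φ y) ^ 2 := by ring
      _ ≤ 9 * 9 := by gcongr
      _ = 81 := by norm_num
  have hA0 : 0 ≤ y ^ 3 * (g y * φ y ^ 2) := by positivity
  have hB : μ * y * (y * φ y) ^ 2 ≤ μ * y * 9 := by gcongr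
  have hB0 : 0 ≤ μ * y * (y * φ y) ^ 2 := by positivity
  calc |φ y + y * φ' y| * c ≤ |φ y + y * φ' y| * -(y ^ 2 * φ' y) := by gcongr
    _ ≤ |φ y + y * φ' y| * |-(y ^ 2 * φ' y)| := by gcongr; exact le_abs_self _
    _ = |(φ y + y * φ' y) * -(y ^ 2 * φ' y)| := (abs_mul _ _).symm
    _ ≤ _ := by
      rw [e, abs_le]
      have : 0 < (y ^ 3)⁻¹ := by positivity
      have : 0 < μ * y := by positivity
      constructor <;> nlinarith

/-- Wronskian with the cosine -/
noncomputable def Wr (k : ℝ) (φ φ' : ℝ → ℝ) (x : ℝ) : ℝ :=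
  (φ x + x * φ' x) * Real.cos (k * x) + k * (x * φ x) * Real.sin (k * x)

lemma Wd (h : IVP 1 μ S φ φ' g w) {k : ℝ} (hk : μ = k ^ 2) {x : ℝ} (hx : x ∈ Ioo 0 S) :
    HasDerivAt (Wr k φ φ') (-(g x * (x * φ x) * Real.cos (k * x))) x := by
  have a1 := h.d1 x hx
  have a2 := h.d2 x hx
  have hc := ((hasDerivAt_id x).const_mul k).cos
  have hs := ((hasDerivAt_id x).const_mul k).sin
  have h1 := ((a1.add ((hasDerivAt_id x).mul a2)).mul hc).add
    ((((hasDerivAt_id x).mul a1).const_mul k).mul hs)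
  refine h1.congr_deriv ?_
  have := hx.1
  simp only [Pi.mul_apply, Pi.add_apply, id]
  rw [hk]
  push_cast
  field_simp
  ring

lemma Wc (h : IVP 1 μ S φ φ' g w) {k : ℝ} : ContinuousOn (Wr k φ φ') (Icc 0 S) := by
  have h0 := h.c0
  have h1 := h.c1
  unfold Wr
  fun_prop

lemma Wbound (h : IVP 1 μ S φ φ' g w) {k : ℝ} (hk0 : 0 < k) (hk1 : k ≤ 1) (hk : μ = k ^ 2)
    {c : ℝ} (hc : c = (2 / 3) ^ 5 / 3)
    {y x : ℝ} (hy : 1 ≤ y) (hyx : y ≤ x) (hx : x ≤ S) :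
    |Wr k φ φ' x| ≤ (27 / c + 9) * (k ^ 2 * y + (y ^ 3)⁻¹) := by
  have hc0 : 0 < c := by rw [hc]; positivity
  have hμ1 : μ ≤ 1 := by rw [hk]; nlinarith
  have hy0 : 0 < y := by linarith
  have hyS : y ≤ S := hyx.trans hx
  have hV' := h.V'_up hμ1 hc ⟨hy, hyS⟩
  have hV'2 : |φ y + y * φ' y| ≤ 27 / c * (k ^ 2 * y + (y ^ 3)⁻¹) := by
    rw [div_mul_eq_mul_div, le_div_iff₀ hc0, ← hk]; exact hV'
  have hV := h.V_up ⟨hy0.le, hyS⟩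
  have hV0 : 0 ≤ y * φ y := mul_nonneg hy0.le (h.nonneg ⟨hy0.le, hyS⟩)
  have hWy : |Wr k φ φ' y| ≤ 27 / c * (k ^ 2 * y + (y ^ 3)⁻¹) + 3 * (k ^ 2 * y) := by
    unfold Wr
    refine (abs_add_le _ _).trans (add_le_add ?_ ?_)
    · rw [abs_mul]
      refine le_trans ?_ hV'2
      exact mul_le_of_le_one_right (abs_nonneg _) (Real.abs_cos_le_one _)
    · rw [abs_mul, abs_of_nonneg (by positivity : 0 ≤ k * (y * φ y))]
      have : |Real.sin (k * y)| ≤ k * y := by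
        have := Real.abs_sin_le_abs (x := k * y)
        rwa [abs_of_nonneg (by positivity : 0 ≤ k * y)] at this
      calc k * (y * φ y) * |Real.sin (k * y)| ≤ k * 3 * (k * y) := by gcongr
        _ = _ := by ring
  have hbd : ∀ z ∈ Ioo y x, |g z * (z * φ z) * Real.cos (k * z)| ≤ 27 * (z ^ 4)⁻¹ := by
    intro z hz
    have hz0 : 0 < z := hy0.trans hz.1
    have hz' : z ∈ Icc 0 S := ⟨hz0.le, hz.2.le.trans hx⟩
    have h1 := h.gup9 hz'
    have h2 := h.V_up hz'
    have h3 := h.gnonneg hz'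
    have h4 : 0 ≤ z * φ z := mul_nonneg hz0.le (h.nonneg hz')
    rw [abs_mul, abs_of_nonneg (mul_nonneg h3 h4)]
    refine (mul_le_of_le_one_right (mul_nonneg h3 h4) (Real.abs_cos_le_one _)).trans ?_
    rw [← div_eq_mul_inv, le_div_iff₀ (by positivity)]
    calc _ = (g z * z ^ 4) * (z * φ z) := by ring
      _ ≤ 9 * 3 := by gcongr
      _ = 27 := by norm_num
  have hdi : ∀ z ∈ Ioo y x, HasDerivAt (fun z : ℝ => 9 * (z ^ 3)⁻¹) (- (27 * (z ^ 4)⁻¹)) z := by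
    intro z hz
    have hz0 : 0 < z := hy0.trans hz.1
    refine (((hasDerivAt_pow 3 z).inv (by positivity)).const_mul 9).congr_deriv ?_
    push_cast
    field_simp
    norm_num
  have hci : ContinuousOn (fun z : ℝ => 9 * (z ^ 3)⁻¹) (Icc y x) := by
    refine continuousOn_const.mul (ContinuousOn.inv₀ (by fun_prop) ?_)
    intro z hz
    have : 0 < z := hy0.trans_le hz.1
    positivity
  have hWc : ContinuousOn (Wr k φ φ') (Icc y x) := h.Wc.mono (Icc_subset_Icc hy0.le hx)
  have k1 := mvt_le (f := fun z => -(9 * (z ^ 3)⁻¹) - Wr k φ φ' z) hyx (hci.neg.sub hWc)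
    (fun z hz => (hdi z hz).neg.sub (h.Wd hk ⟨hy0.trans hz.1, hz.2.trans_le hx⟩))
    (fun z hz => by have := abs_le.1 (hbd z hz); linarith [this.1])
  have k2 := mvt_le (f := fun z => -(9 * (z ^ 3)⁻¹) + Wr k φ φ' z) hyx (hci.neg.add hWc)
    (fun z hz => (hdi z hz).neg.add (h.Wd hk ⟨hy0.trans hz.1, hz.2.trans_le hx⟩))
    (fun z hz => by have := abs_le.1 (hbd z hz); linarith [this.2])
  have hx0 : 0 < x := hy0.trans_le hyx
  have p1 : 0 < (x ^ 3)⁻¹ := by positivity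
  have p2 : 0 < k ^ 2 * y := by positivity
  have := abs_le.1 hWy
  rw [abs_le]
  constructor <;> nlinarith [this.1, this.2]

lemma three (h : IVP 1 μ S φ φ' g w) {κ c C δ : ℝ} (hκ : 0 < κ) (hμκ : μ = κ ^ 4)
    (hc : c = (2 / 3) ^ 5 / 3) (hC : C = 2 * (27 / c + 9)) (hκc : κ ≤ c / 5)
    (hδ : 0 < δ) (hδ4 : δ ≤ π / 4) (hsmall : (π / 2 + δ) * (C * κ) < c * Real.sin δ) :
    |κ ^ 2 * S - π / 2| ≤ δ := by
  have hc0 : 0 < c := by rw [hc]; positivity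
  have hκ1 : κ ≤ 1 := hκc.trans (by rw [hc]; norm_num)
  have hk : μ = (κ ^ 2) ^ 2 := by rw [hμκ]; ring
  have hk0 : 0 < κ ^ 2 := by positivity
  have hk1 : κ ^ 2 ≤ 1 := by nlinarith
  have hμ1 : μ ≤ 1 := by rw [hk]; nlinarith
  have hS1 := h.one_le_S hμ1
  have hS0 := h.hS
  have hpi := Real.pi_gt_three
  have hF : ∀ y ∈ Icc 1 S, c ≤ -(y ^ 2 * φ' y) := by
    intro y hy
    have := h.Flow1 hμ1 hy
    norm_num at this
    rw [hc]; norm_num; exact this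
  -- lower bound on S
  have hSlow : c / 5 ≤ κ ^ 2 * S := by
    have h1 := h.P_up (y := S) ⟨hS0.le, le_rfl⟩
    rw [h.PS] at h1
    have h2 := hF S ⟨hS1, le_rfl⟩
    have h3 : c ^ 2 ≤ (-(S ^ 2 * φ' S)) ^ 2 := by gcongr
    have h4 : (-(S ^ 2 * φ' S)) ^ 2 = 2 * S * (S ^ (1 + 2) * φ' S ^ 2 / 2) := by ring
    have h5 : c ^ 2 ≤ 2 * S * (9 * μ * S) := by
      rw [h4] at h3
      exact h3.trans (by gcongr)
    have h6 : c ^ 2 ≤ 18 * (κ ^ 2 * S) ^ 2 := by rw [hk] at h5; linarith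
    by_contra hcon
    push Not at hcon
    have h7 : (κ ^ 2 * S) ^ 2 ≤ (c / 5) ^ 2 := by gcongr
    nlinarith
  have hinvS : κ⁻¹ ≤ S := by
    rw [inv_le_iff_one_le_mul₀ hκ]
    have : κ * 1 ≤ κ * (κ * S) := by nlinarith
    have := le_of_mul_le_mul_left this hκ
    linarith
  have hinv1 : 1 ≤ κ⁻¹ := (one_le_inv₀ hκ).2 hκ1
  have hW : ∀ x, κ⁻¹ ≤ x → x ≤ S → |Wr (κ ^ 2) φ φ' x| ≤ κ ^ 2 * (C * κ) := by
    intro x hx hxS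
    refine (h.Wbound hk0 hk1 hk hc hinv1 hx hxS).trans_eq ?_
    rw [hC]; field_simp; ring
  have hsin : 0 < Real.sin δ := Real.sin_pos_of_pos_of_lt_pi hδ (by linarith)
  -- upper bound
  have hup : κ ^ 2 * S ≤ π / 2 + δ := by
    by_contra hcon
    push Not at hcon
    set x := (π / 2 + δ) / κ ^ 2 with hxdef
    have hkx : κ ^ 2 * x = π / 2 + δ := by rw [hxdef]; field_simp
    have hxS : x ≤ S := by rw [hxdef, div_le_iff₀ hk0]; linarith
    have hx1 : κ⁻¹ ≤ x := by
      rw [hxdef, le_div_iff₀ hk0]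
      have : κ⁻¹ * κ ^ 2 = κ := by field_simp
      rw [this]; linarith
    have hx0 : 0 < x := by linarith
    have h1 := hW x hx1 hxS
    have h2 := hF x ⟨hinv1.trans hx1, hxS⟩
    have hV0 : 0 ≤ x * φ x := mul_nonneg hx0.le (h.nonneg ⟨hx0.le, hxS⟩)
    have e : x * Wr (κ ^ 2) φ φ' x = (x * φ x) * ((π / 2 + δ) * Real.cos δ - Real.sin δ)
        + -(x ^ 2 * φ' x) * Real.sin δ := by
      unfold Wr
      rw [hkx]
      have e1 : Real.cos (π / 2 + δ) = - Real.sin δ := by rw [add_comm, Real.cos_add_pi_div_two]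
      have e2 : Real.sin (π / 2 + δ) = Real.cos δ := by rw [add_comm, Real.sin_add_pi_div_two]
      rw [e1, e2, ← hkx]; ring
    have hsc : Real.sin δ ≤ Real.cos δ := by
      rw [← Real.cos_pi_div_two_sub]
      exact Real.cos_le_cos_of_nonneg_of_le_pi hδ.le (by linarith) (by linarith)
    have h3 : 0 ≤ (π / 2 + δ) * Real.cos δ - Real.sin δ := by nlinarith
    have h4 : c * Real.sin δ ≤ x * Wr (κ ^ 2) φ φ' x := by
      rw [e]
      have := mul_nonneg hV0 h3
      nlinarith
    have h5 : x * Wr (κ ^ 2) φ φ' x ≤ x * (κ ^ 2 * (C * κ)) := by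
      gcongr; exact (le_abs_self _).trans h1
    have h6 : x * (κ ^ 2 * (C * κ)) = (π / 2 + δ) * (C * κ) := by rw [← hkx]; ring
    linarith
  have hcos : |Real.cos (κ ^ 2 * S)| < Real.sin δ := by
    have h1 := hW S hinvS le_rfl
    have h2 := hF S ⟨hS1, le_rfl⟩
    have e : S * |Wr (κ ^ 2) φ φ' S| = -(S ^ 2 * φ' S) * |Real.cos (κ ^ 2 * S)| := by
      unfold Wr
      rw [h.zS]
      have : (0 + S * φ' S) * Real.cos (κ ^ 2 * S) + κ ^ 2 * (S * 0) * Real.sin (κ ^ 2 * S)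
        = S * φ' S * Real.cos (κ ^ 2 * S) := by ring
      rw [this, abs_mul, abs_mul, abs_of_pos hS0,
        abs_of_nonpos (h.dnonpos (ρ := S) ⟨hS0.le, le_rfl⟩)]
      ring
    have h3 : c * |Real.cos (κ ^ 2 * S)| ≤ S * |Wr (κ ^ 2) φ φ' S| := by
      rw [e]; gcongr
    have h4 : S * |Wr (κ ^ 2) φ φ' S| ≤ S * (κ ^ 2 * (C * κ)) := by gcongr
    have hC0 : 0 < C := by rw [hC]; positivity
    have h5 : S * (κ ^ 2 * (C * κ)) ≤ (π / 2 + δ) * (C * κ) := by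
      calc _ = (κ ^ 2 * S) * (C * κ) := by ring
        _ ≤ _ := by gcongr
    have h6 : c * |Real.cos (κ ^ 2 * S)| < c * Real.sin δ := by linarith
    exact lt_of_mul_lt_mul_left h6 hc0.le
  rw [abs_le]
  refine ⟨?_, by linarith⟩
  by_contra hcon
  push Not at hcon
  have h1 : Real.cos (π / 2 - δ) ≤ Real.cos (κ ^ 2 * S) :=
    Real.cos_le_cos_of_nonneg_of_le_pi (by positivity) (by linarith) (by linarith)
  rw [Real.cos_pi_div_two_sub] at h1
  linarith [le_abs_self (Real.cos (κ ^ 2 * S))]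

end IVP
end BN

namespace BN

lemma toIVP {D m : ℕ} (hD : 1 ≤ D) {lam R : ℝ} {u u' u'' : ℝ → ℝ} (hlam : 0 < lam)
    (h : BNSol (D + 2) lam m u u' u'') (hR : IsFirstZero u R) :
    ∃ φ φ' g w : ℝ → ℝ, IVP D (lam / ((u 0) ^ ((2:ℝ) / D)) ^ 2) ((u 0) ^ ((2:ℝ) / D) * R)
      φ φ' g w := by
  set a := u 0 with ha
  have ha0 : 0 < a := h.pos_zero
  set α := a ^ ((2:ℝ) / D) with hα
  have hα0 : 0 < α := rpow_pos_of_pos ha0 _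
  have hDr : (0:ℝ) < D := by exact_mod_cast hD
  obtain ⟨⟨hR0, hR1⟩, hR2, hR3⟩ := hR
  have hmap : ∀ ρ ∈ Icc 0 (α * R), ρ / α ∈ Icc (0:ℝ) 1 := by
    intro ρ hρ
    refine ⟨div_nonneg hρ.1 hα0.le, ?_⟩
    rw [div_le_one hα0]
    have := hρ.2
    nlinarith
  have hmap' : ∀ ρ ∈ Ioo 0 (α * R), ρ / α ∈ Ioo (0:ℝ) R := by
    intro ρ hρ
    refine ⟨div_pos hρ.1 hα0, ?_⟩
    rw [div_lt_iff₀ hα0]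
    linarith [hρ.2]
  have huc : ContinuousOn u (Icc 0 1) := fun x hx => (h.deriv_fst x hx).continuousWithinAt
  have huc' : ContinuousOn u' (Icc 0 1) := fun x hx => (h.deriv_snd x hx).continuousWithinAt
  have hupos : ∀ x ∈ Ioo 0 R, 0 < u x := by
    intro x hx
    by_contra hc
    push Not at hc
    have : (0:ℝ) ∈ Icc (u x) (u 0) := ⟨hc, ha0.le⟩
    have hiv := intermediate_value_Icc' hx.1.le
      (huc.mono (Icc_subset_Icc le_rfl (hx.2.le.trans hR1))) this
    obtain ⟨y, hy, hy0⟩ := hiv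
    have hyne : y ≠ 0 := by
      rintro rfl
      exact h.pos_zero.ne' hy0
    exact hR3 y ⟨lt_of_le_of_ne hy.1 hyne.symm, hy.2.trans_lt hx.2⟩ hy0
  have hdiv : ∀ ρ : ℝ, HasDerivAt (fun x : ℝ => x / α) (1 / α) ρ := fun ρ =>
    (hasDerivAt_id ρ).div_const α
  have hnh : ∀ x ∈ Ioo 0 R, Icc (0:ℝ) 1 ∈ 𝓝 x := fun x hx =>
    Icc_mem_nhds hx.1 (hx.2.trans_le hR1)
  refine ⟨fun ρ => u (ρ / α) / a, fun ρ => u' (ρ / α) / (a * α),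
    fun ρ => (u (ρ / α) / a) ^ ((4:ℝ) / D), fun ρ => (u (ρ / α) / a) ^ (-((2:ℝ) / D)), ?_⟩
  refine
   { hD := hD
     hμ := by positivity
     hS := by positivity
     c0 := ?_, c1 := ?_, d1 := ?_, d2 := ?_
     z0 := by simp [← ha, ha0.ne']
     z1 := by simp [h.bc_deriv_zero]
     zS := by simp [mul_div_cancel_left₀ _ hα0.ne', hR2]
     pos := fun ρ hρ => div_pos (hupos _ (hmap' ρ hρ)) ha0
     hg := rfl
     hw := rfl }
  · exact (huc.comp (by fun_prop) hmap).div_const a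
  · exact (huc'.comp (by fun_prop) hmap).div_const _
  · intro ρ hρ
    have hx := hmap' ρ hρ
    have h1 := (h.deriv_fst (ρ / α) ⟨hx.1.le, hx.2.le.trans hR1⟩).hasDerivAt (hnh _ hx)
    refine ((h1.comp ρ (hdiv ρ)).div_const a).congr_deriv ?_
    field_simp
  · intro ρ hρ
    have hx := hmap' ρ hρ
    have h1 := (h.deriv_snd (ρ / α) ⟨hx.1.le, hx.2.le.trans hR1⟩).hasDerivAt (hnh _ hx)
    refine ((h1.comp ρ (hdiv ρ)).div_const (a * α)).congr_deriv ?_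
    have ho := h.ode (ρ / α) ⟨hx.1, hx.2.trans_le hR1⟩
    have hup := hupos _ hx
    have e1 : (((D + 2 : ℕ) : ℝ) - 2) = D := by push_cast; ring
    have e2 : (((D + 2 : ℕ) : ℝ) - 1) = D + 1 := by push_cast; ring
    rw [e1, e2, abs_of_pos hup] at ho
    have e3 : u (ρ / α) ^ ((4:ℝ) / D) = α ^ 2 * (u (ρ / α) / a) ^ ((4:ℝ) / D) := by
      rw [div_rpow hup.le ha0.le, hα, ← rpow_natCast, ← rpow_mul ha0.le]
      have : (2:ℝ) / D * (2:ℕ) = 4 / D := by push_cast; ring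
      rw [this, mul_div_cancel₀]
      exact (rpow_pos_of_pos ha0 _).ne'
    rw [e3] at ho
    have hρ0 := hρ.1
    have e4 : u'' (ρ / α) = -((D + 1) / (ρ / α) * u' (ρ / α)) -
      α ^ 2 * (u (ρ / α) / a) ^ ((4:ℝ) / D) * u (ρ / α) - lam * u (ρ / α) := by linarith
    rw [e4]
    generalize (u (ρ / α) / a) ^ ((4:ℝ) / D) = G
    field_simp

lemma final_high {D m : ℕ} (hD : 2 ≤ D) {lamBar : ℝ} (hlamBar : 0 < lamBar)
    {lam : ℕ → ℝ} (hlam : Tendsto lam atTop (𝓝 lamBar))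
    {u u' u'' : ℕ → ℝ → ℝ} {r : ℕ → ℝ}
    (hsol : ∀ n, BNSol (D + 2) (lam n) m (u n) (u' n) (u'' n))
    (hfz : ∀ n, IsFirstZero (u n) (r n))
    (hblow : Tendsto (fun n => u n 0) atTop atTop) : Tendsto r atTop (𝓝 0) := by
  have hDr : (0:ℝ) < D := by have : 0 < D := by omega
                             exact_mod_cast this
  obtain ⟨C, hC⟩ := IVP.high_all D hD (lamBar + 1)
  have hα : Tendsto (fun n => (u n 0) ^ ((2:ℝ) / D)) atTop atTop :=
    (tendsto_rpow_atTop (by positivity)).comp hblow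
  rw [Metric.tendsto_atTop']
  intro ε hε
  have hbig : Tendsto (fun n => lamBar / 2 * ε ^ 2 * Real.log ((u n 0) ^ ((2:ℝ) / D) * ε / 2)) atTop atTop := by
    refine Tendsto.const_mul_atTop (by positivity) (Real.tendsto_log_atTop.comp ?_)
    exact (hα.atTop_mul_const hε).atTop_div_const (by norm_num)
  have hS : Tendsto (fun n => (u n 0) ^ ((2:ℝ) / D) * ε) atTop atTop := hα.atTop_mul_const hε
  have hev : ∀ᶠ n in atTop, dist (r n) 0 < ε := by
    filter_upwards [hbig.eventually_gt_atTop C, hS.eventually_ge_atTop 2,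
      hα.eventually_ge_atTop (lamBar + 1), hlam.eventually (lt_mem_nhds (half_lt_self hlamBar)),
      hlam.eventually (gt_mem_nhds (lt_add_one lamBar))] with n h1 h2 h3 h4 h5
    have hr0 : 0 < r n := (hfz n).1.1
    have hr1 : r n ≤ 1 := (hfz n).1.2
    rw [Real.dist_eq, sub_zero, abs_of_pos hr0]
    by_contra hcon
    push Not at hcon
    have hl0 : 0 < lam n := by linarith
    obtain ⟨φ, φ', g, w, hi⟩ := toIVP (by omega) hl0 (hsol n) (hfz n)
    set α := (u n 0) ^ ((2:ℝ) / D)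
    have hα1 : 0 < α := by linarith
    have e : lam n / α ^ 2 * (α * r n) ^ 2 = lam n * r n ^ 2 := by field_simp
    have h6 := hC _ _ _ _ _ _ hi (by
      rw [div_le_one (by positivity)]; nlinarith) (by nlinarith) (by
      rw [e]
      have : r n ^ 2 ≤ 1 := pow_le_one₀ hr0.le hr1
      nlinarith)
    rw [e] at h6
    have h7 : lamBar / 2 * ε ^ 2 * Real.log (α * ε / 2) ≤ lam n * r n ^ 2 * Real.log (α * r n / 2) := by
      have : 0 ≤ Real.log (α * ε / 2) := Real.log_nonneg (by linarith)
      have hle : Real.log (α * ε / 2) ≤ Real.log (α * r n / 2) :=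
        Real.log_le_log (by positivity) (by gcongr)
      gcongr
    linarith
  obtain ⟨n0, hn0⟩ := eventually_atTop.1 hev
  exact ⟨n0, fun n hn => hn0 n hn.le⟩

lemma final_three {m : ℕ} {lamBar : ℝ} (hlamBar : 0 < lamBar)
    {lam : ℕ → ℝ} (hlam : Tendsto lam atTop (𝓝 lamBar))
    {u u' u'' : ℕ → ℝ → ℝ} {r : ℕ → ℝ}
    (hsol : ∀ n, BNSol (1 + 2) (lam n) m (u n) (u' n) (u'' n))
    (hfz : ∀ n, IsFirstZero (u n) (r n))
    (hblow : Tendsto (fun n => u n 0) atTop atTop) :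
    Tendsto r atTop (𝓝 (π / (2 * Real.sqrt lamBar))) := by
  have hα : Tendsto (fun n => (u n 0) ^ ((2:ℝ) / (1:ℕ))) atTop atTop :=
    (tendsto_rpow_atTop (by positivity)).comp hblow
  have hsq : Tendsto (fun n => Real.sqrt (lam n)) atTop (𝓝 (Real.sqrt lamBar)) := hlam.sqrt
  have hs0 : 0 < Real.sqrt lamBar := Real.sqrt_pos.2 hlamBar
  have hκ : Tendsto (fun n => Real.sqrt (Real.sqrt (lam n) / (u n 0) ^ ((2:ℝ) / (1:ℕ)))) atTop (𝓝 0) := by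
    have := (hsq.div_atTop hα).sqrt
    rwa [Real.sqrt_zero] at this
  set c : ℝ := (2 / 3) ^ 5 / 3 with hc
  set C : ℝ := 2 * (27 / c + 9) with hC
  have hc0 : 0 < c := by rw [hc]; positivity
  have main : Tendsto (fun n => Real.sqrt (lam n) * r n) atTop (𝓝 (π / 2)) := by
    rw [Metric.tendsto_atTop']
    intro ε hε
    set δ := min (ε / 2) (π / 4) with hδ
    have hpi := Real.pi_pos
    have hδ0 : 0 < δ := lt_min (by positivity) (by positivity)
    have hsin : 0 < Real.sin δ := Real.sin_pos_of_pos_of_lt_pi hδ0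
      ((min_le_right _ _).trans_lt (by linarith))
    have hsm : Tendsto (fun n => (π / 2 + δ) * (C * Real.sqrt (Real.sqrt (lam n) / (u n 0) ^ ((2:ℝ) / (1:ℕ)))))
        atTop (𝓝 0) := by
      have := (hκ.const_mul C).const_mul (π / 2 + δ)
      simpa using this
    have hev : ∀ᶠ n in atTop, dist (Real.sqrt (lam n) * r n) (π / 2) < ε := by
      filter_upwards [hsm.eventually (gt_mem_nhds (mul_pos hc0 hsin)),
        hκ.eventually (gt_mem_nhds (by positivity : 0 < c / 5)),
        hlam.eventually (lt_mem_nhds hlamBar)] with n h1 h2 h3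
      obtain ⟨φ, φ', g, w, hi⟩ := toIVP le_rfl h3 (hsol n) (hfz n)
      have ha : 0 < u n 0 := (hsol n).pos_zero
      have hα0 : 0 < (u n 0) ^ ((2:ℝ) / (1:ℕ)) := rpow_pos_of_pos ha _
      set α := (u n 0) ^ ((2:ℝ) / (1:ℕ))
      have hl := Real.sqrt_pos.2 h3
      have e2 : Real.sqrt (Real.sqrt (lam n) / α) ^ 2 = Real.sqrt (lam n) / α :=
        Real.sq_sqrt (by positivity)
      have h4 := hi.three (κ := Real.sqrt (Real.sqrt (lam n) / α)) (Real.sqrt_pos.2 (by positivity)) (by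
        calc lam n / α ^ 2 = (Real.sqrt (lam n) / α) ^ 2 := by rw [div_pow, Real.sq_sqrt h3.le]
          _ = (Real.sqrt (Real.sqrt (lam n) / α) ^ 2) ^ 2 := by rw [e2]
          _ = _ := by ring) hc hC h2.le hδ0 (min_le_right _ _) h1
      rw [e2] at h4
      have e3 : Real.sqrt (lam n) / α * (α * r n) = Real.sqrt (lam n) * r n := by field_simp
      rw [e3] at h4
      rw [Real.dist_eq]
      have : δ ≤ ε / 2 := min_le_left _ _
      linarith
    obtain ⟨n0, hn0⟩ := eventually_atTop.1 hev
    exact ⟨n0, fun n hn => hn0 n hn.le⟩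
  have hfin := main.div hsq hs0.ne'
  have e : π / 2 / Real.sqrt lamBar = π / (2 * Real.sqrt lamBar) := by rw [div_div]
  rw [e] at hfin
  refine hfin.congr' ?_
  filter_upwards [hlam.eventually (lt_mem_nhds hlamBar)] with n hn
  have := Real.sqrt_pos.2 hn
  simp only [Pi.div_apply]
  field_simp

end BN

theorem statement1 (N : ℕ) (hN : N = 3 ∨ N = 4 ∨ N = 5 ∨ N = 6)
    (m : ℕ) (hm : 1 ≤ m) (lamBar : ℝ) (hlamBar : 0 < lamBar)
    (lam : ℕ → ℝ) (hlam : Tendsto lam atTop (𝓝 lamBar))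
    (u u' u'' : ℕ → ℝ → ℝ) (r : ℕ → ℝ)
    (hsol : ∀ n, BNSol N (lam n) m (u n) (u' n) (u'' n))
    (hfz : ∀ n, IsFirstZero (u n) (r n))
    (hblow : Tendsto (fun n => u n 0) atTop atTop) :
    ((N = 4 ∨ N = 5 ∨ N = 6) → Tendsto r atTop (𝓝 0)) ∧
    (N = 3 → Tendsto r atTop (𝓝 (π / (2 * Real.sqrt lamBar)))) := by
  refine ⟨fun h => ?_, fun h => ?_⟩
  · rcases h with rfl | rfl | rfl
    · exact BN.final_high (D := 2) (by norm_num) hlamBar hlam hsol hfz hblow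
    · exact BN.final_high (D := 3) (by norm_num) hlamBar hlam hsol hfz hblow
    · exact BN.final_high (D := 4) (by norm_num) hlamBar hlam hsol hfz hblow
  · subst h
    exact BN.final_three hlamBar hlam hsol hfz hblow
end

section
/- Let N ≥ 3, λ ∈ ℝ, and let u ∈ C²([0,1],ℝ) satisfy u''(r) + ((N−1)/r)·u'(r) + |u(r)|^{4/(N−2)}·u(r) + λ·u(r) = 0 on (0,1) with u'(0) = 0 and u(1) = 0. Let ρ ∈ (0,1] be a zero of u. Then for all 0 < a ≤ 1 and 0 < b ≤ 1, writing g(r) = |u(r)|^{4/(N−2)}·u(r) + λ·u(r): u(a) = (b^{N−1}/(N−2))·u'(b)·( ρ^{2−N} − a^{2−N} ) + (1/(N−2))·[ ∫_a^ρ r·g(r) dr + ρ^{2−N}·∫_ρ^b r^{N−1}·g(r) dr − a^{2−N}·∫_a^b r^{N−1}·g(r) dr ], where all integrals are signed (oriented) integrals. -/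
open Real Set Filter Topology intervalIntegral

/-- Fundamental theorem of calculus on subintervals of `(0,1]`. -/
theorem ftc_aux (F f : ℝ → ℝ) (hF : ContinuousOn F (Icc (0:ℝ) 1))
    (hf : ContinuousOn f (Icc (0:ℝ) 1))
    (hd : ∀ r ∈ Ioo (0:ℝ) 1, HasDerivAt F (-f r) r)
    (x y : ℝ) (hx : x ∈ Ioc (0:ℝ) 1) (hy : y ∈ Ioc (0:ℝ) 1) :
    ∫ s in x..y, f s = F x - F y := by
  have hsub : uIcc x y ⊆ Icc (0:ℝ) 1 :=
    uIcc_subset_Icc ⟨hx.1.le, hx.2⟩ ⟨hy.1.le, hy.2⟩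
  have h := intervalIntegral.integral_eq_sub_of_hasDeriv_right (f := F) (f' := fun s => -f s)
    (a := x) (b := y) (hF.mono hsub)
    (fun r hr => (hd r ⟨lt_trans (lt_min hx.1 hy.1) hr.1,
      lt_of_lt_of_le hr.2 (max_le hx.2 hy.2)⟩).hasDerivWithinAt)
    ((hf.mono hsub).neg.intervalIntegrable)
  rw [intervalIntegral.integral_neg] at h
  linarith

theorem statement5 (N : ℕ) (hN : 3 ≤ N) (lam : ℝ) (u u' u'' : ℝ → ℝ)
    (hd1 : ∀ r ∈ Set.Icc (0:ℝ) 1, HasDerivWithinAt u (u' r) (Set.Icc (0:ℝ) 1) r)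
    (hd2 : ∀ r ∈ Set.Icc (0:ℝ) 1, HasDerivWithinAt u' (u'' r) (Set.Icc (0:ℝ) 1) r)
    (hcont : ContinuousOn u'' (Set.Icc (0:ℝ) 1))
    (hode : ∀ r ∈ Set.Ioo (0:ℝ) 1,
      u'' r + (((N:ℝ) - 1) / r) * u' r + |u r| ^ ((4:ℝ) / ((N:ℝ) - 2)) * u r + lam * u r = 0)
    (hbc0 : u' 0 = 0) (hbc1 : u 1 = 0)
    (ρ : ℝ) (hρ : ρ ∈ Set.Ioc (0:ℝ) 1) (hzero : u ρ = 0)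
    (a b : ℝ) (ha0 : 0 < a) (ha1 : a ≤ 1) (hb0 : 0 < b) (hb1 : b ≤ 1) :
    u a = b ^ ((N:ℝ) - 1) / ((N:ℝ) - 2) * u' b *
        (ρ ^ ((2:ℝ) - (N:ℝ)) - a ^ ((2:ℝ) - (N:ℝ))) +
      (1 / ((N:ℝ) - 2)) *
        ((∫ s in a..ρ, s * (|u s| ^ ((4:ℝ) / ((N:ℝ) - 2)) * u s + lam * u s)) +
          ρ ^ ((2:ℝ) - (N:ℝ)) *
            (∫ s in ρ..b, s ^ ((N:ℝ) - 1) * (|u s| ^ ((4:ℝ) / ((N:ℝ) - 2)) * u s + lam * u s)) -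
          a ^ ((2:ℝ) - (N:ℝ)) *
            (∫ s in a..b, s ^ ((N:ℝ) - 1) * (|u s| ^ ((4:ℝ) / ((N:ℝ) - 2)) * u s + lam * u s))) := by
  have hN3 : (3:ℝ) ≤ (N:ℝ) := by exact_mod_cast hN
  have hN2 : (0:ℝ) < (N:ℝ) - 2 := by linarith
  have cu : ContinuousOn u (Icc (0:ℝ) 1) := fun r hr => (hd1 r hr).continuousWithinAt
  have cu' : ContinuousOn u' (Icc (0:ℝ) 1) := fun r hr => (hd2 r hr).continuousWithinAt
  have cg : ContinuousOn (fun s => |u s| ^ ((4:ℝ) / ((N:ℝ) - 2)) * u s + lam * u s)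
      (Icc (0:ℝ) 1) :=
    ((cu.abs.rpow_const (fun _ _ => Or.inr (by positivity))).mul cu).add
      (continuousOn_const.mul cu)
  have cp : ContinuousOn (fun s : ℝ => s ^ ((N:ℝ) - 1)) (Icc (0:ℝ) 1) :=
    continuousOn_id.rpow_const (fun _ _ => Or.inr (by linarith))
  have D1 : ∀ r ∈ Ioo (0:ℝ) 1, HasDerivAt u (u' r) r := fun r hr =>
    (hd1 r (Ioo_subset_Icc_self hr)).hasDerivAt (Icc_mem_nhds hr.1 hr.2)
  have D2 : ∀ r ∈ Ioo (0:ℝ) 1, HasDerivAt u' (u'' r) r := fun r hr =>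
    (hd2 r (Ioo_subset_Icc_self hr)).hasDerivAt (Icc_mem_nhds hr.1 hr.2)
  have I1 := ftc_aux (fun s => s ^ ((N:ℝ) - 1) * u' s)
    (fun s => s ^ ((N:ℝ) - 1) * (|u s| ^ ((4:ℝ) / ((N:ℝ) - 2)) * u s + lam * u s))
    (cp.mul cu') (cp.mul cg) (by
      intro r hr
      have h := (Real.hasDerivAt_rpow_const (x := r) (p := (N:ℝ) - 1)
        (Or.inl hr.1.ne')).mul (D2 r hr)
      refine HasDerivAt.congr_deriv h ?_
      have e := hode r hr
      have e1 : r ^ ((N:ℝ) - 1 - 1) = r ^ ((N:ℝ) - 1) / r := Real.rpow_sub_one hr.1.ne' _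
      rw [e1]
      linear_combination (r ^ ((N:ℝ) - 1)) * e)
  have I2 := ftc_aux (fun s => s * u' s + ((N:ℝ) - 2) * u s)
    (fun s => s * (|u s| ^ ((4:ℝ) / ((N:ℝ) - 2)) * u s + lam * u s))
    ((continuousOn_id.mul cu').add (continuousOn_const.mul cu)) (continuousOn_id.mul cg) (by
      intro r hr
      have h := ((hasDerivAt_id r).mul (D2 r hr)).add ((D1 r hr).const_mul ((N:ℝ) - 2))
      refine HasDerivAt.congr_deriv h ?_
      have e := hode r hr
      have e1 : r * (((N:ℝ) - 1) / r) = (N:ℝ) - 1 := mul_div_cancel₀ _ hr.1.ne'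
      simp only [id]
      linear_combination r * e - u' r * e1)
  have ha : a ∈ Ioc (0:ℝ) 1 := ⟨ha0, ha1⟩
  have hb : b ∈ Ioc (0:ℝ) 1 := ⟨hb0, hb1⟩
  have key : ∀ x : ℝ, 0 < x → x ^ ((2:ℝ) - (N:ℝ)) * x ^ ((N:ℝ) - 1) = x := by
    intro x hx
    rw [← Real.rpow_add hx]
    have : (2:ℝ) - (N:ℝ) + ((N:ℝ) - 1) = 1 := by ring
    rw [this, Real.rpow_one]
  rw [I2 a ρ ha hρ, I1 ρ b hρ hb, I1 a b ha hb, hzero]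
  have ka := key a ha0
  have kρ := key ρ hρ.1
  field_simp
  linear_combination u' a * ka - u' ρ * kρ
end
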